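/- arXiv:1806.09263 — 7 statements merged into one kernel-verified Lean document; each statement's English description precedes it below -/
import Mathlib

section
/- For every integer n ≥ 2, the algebra E_n^! is a Noetherian ring (both left and right Noetherian). -/
/- The quadratic dual Fomin–Kirillov algebra `E_n^!` over an algebraically
closed field `k` of characteristic zero, presented as a quotient of the free
algebra on generators `y_{i,j}` (for `1 ≤ i < j ≤ n`, realized here with
`0`-based indexing by the subtype of pairs `(i,j) : Fin n × Fin n` with `i < j`),
with the convention `y_{j,i} = -y_{i,j}`. -/

noncomputable section

variable (k : Type) [Field k] [IsAlgClosed k] [CharZero k]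

/-- Index set for the generators: pairs `(i,j)` with `i < j`. -/
abbrev FKIdx (n : ℕ) := {p : Fin n × Fin n // p.1 < p.2}

/-- The element `y_{i,j}` of the free algebra, with the convention
`y_{j,i} = -y_{i,j}` (and `y_{i,i} = 0`, which is never used). -/
def Ygen (n : ℕ) (i j : Fin n) : FreeAlgebra k (FKIdx n) :=
  if h : i < j then FreeAlgebra.ι k ⟨(i, j), h⟩
  else if h' : j < i then - FreeAlgebra.ι k ⟨(j, i), h'⟩
  else 0

/-- The defining relations of `E_n^!`. -/
inductive FKRel (n : ℕ) : FreeAlgebra k (FKIdx n) → FreeAlgebra k (FKIdx n) → Prop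
  | triple (i j l : Fin n) (hij : i ≠ j) (hjl : j ≠ l) (hil : i ≠ l) :
      FKRel n (Ygen k n i j * Ygen k n j l + Ygen k n j l * Ygen k n i l) 0
  | disj (i j s t : Fin n) (hij : i < j) (hst : s < t)
      (h1 : i ≠ s) (h2 : i ≠ t) (h3 : j ≠ s) (h4 : j ≠ t) :
      FKRel n (Ygen k n i j * Ygen k n s t + Ygen k n s t * Ygen k n i j) 0

/-- The quadratic dual Fomin–Kirillov algebra `E_n^!`. -/
abbrev FKDual (n : ℕ) := RingQuot (FKRel k n)

/-- The generator `y_{i,j}` of `E_n^!`. -/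
def yy (n : ℕ) (i j : Fin n) : FKDual k n :=
  RingQuot.mkAlgHom k (FKRel k n) (Ygen k n i j)

theorem fkAux_split {I : Type} (l : List I) (h : ¬ l.Nodup) :
    ∃ s l1 l2 l3, l = l1 ++ s :: (l2 ++ s :: l3) := by
  induction l with
  | nil => simp at h
  | cons a t ih =>
    by_cases ha : a ∈ t
    · obtain ⟨u, v, rfl⟩ := List.append_of_mem ha
      exact ⟨a, [], u, v, rfl⟩
    · have : ¬ t.Nodup := fun ht => h (List.nodup_cons.2 ⟨ha, ht⟩)
      obtain ⟨s, l1, l2, l3, rfl⟩ := ih this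
      exact ⟨s, a :: l1, l2, l3, rfl⟩

section fkAux
variable {K R I : Type} [Field K] [Ring R] [Algebra K R]
  (y : I → R) (act : I → I → I)

theorem fkAux_move (h : ∀ p q, y p * y q = - (y q * y (act q p))) (s : I) (l : List I) :
    ∃ l' : List I, l'.length = l.length ∧
      ((l.map y).prod * y s = y s * (l'.map y).prod ∨
        (l.map y).prod * y s = - (y s * (l'.map y).prod)) := by
  induction l with
  | nil => exact ⟨[], rfl, by simp⟩
  | cons a t ih =>
    obtain ⟨l', hl, h'⟩ := ih
    refine ⟨act s a :: l', by simp [hl], ?_⟩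
    rcases h' with h' | h'
    · right
      simp only [List.map_cons, List.prod_cons, mul_assoc, h']
      rw [← mul_assoc, h, neg_mul, mul_assoc]
    · left
      simp only [List.map_cons, List.prod_cons, mul_assoc, h']
      rw [mul_neg, ← mul_assoc, h, neg_mul, mul_assoc, neg_neg]

theorem fkAux_noeth [Fintype I]
    (h : ∀ p q, y p * y q = - (y q * y (act q p))) (hact : ∀ p q, act q (act q p) = p)
    (htop : Algebra.adjoin K (Set.range y) = ⊤) :
    IsNoetherianRing R ∧ IsNoetherianRing Rᵐᵒᵖ := by
  have hc1 : ∀ s p, y p * (y s * y s) = (y s * y s) * y p := by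
    intro s p
    rw [← mul_assoc, h p s, neg_mul, mul_assoc, h (act s p) s, hact, mul_neg, neg_neg, mul_assoc]
  have hc : ∀ s, y s * y s ∈ Subalgebra.center K R := by
    intro s
    rw [Subalgebra.mem_center_iff]
    intro b
    have hb : b ∈ Algebra.adjoin K (Set.range y) := by rw [htop]; trivial
    induction hb using Algebra.adjoin_induction with
    | mem x hx => obtain ⟨p, rfl⟩ := hx; exact hc1 s p
    | algebraMap r => exact Algebra.commutes r _
    | add a b _ _ ha hb => rw [add_mul, mul_add, ha, hb]
    | mul a b _ _ ha hb => rw [mul_assoc, hb, ← mul_assoc, ha, mul_assoc]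
  let φ : MvPolynomial I K →ₐ[K] Subalgebra.center K R :=
    MvPolynomial.aeval (fun s => ⟨y s * y s, hc s⟩)
  let ψ : MvPolynomial I K →+* R := (Subalgebra.center K R).val.toRingHom.comp φ.toRingHom
  have hψ : ∀ c x, ψ c * x = x * ψ c := fun c x =>
    ((Subalgebra.mem_center_iff.1 (φ c).2) x).symm
  let _ : Algebra (MvPolynomial I K) R := ψ.toAlgebra' hψ
  have hsm : ∀ (c : MvPolynomial I K) (x : R), c • x = ψ c * x := fun _ _ => rfl
  have hX : ∀ s, ψ (MvPolynomial.X s) = y s * y s := by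
    intro s; simp [ψ, φ]
  have hC : ∀ r, ψ (MvPolynomial.C r) = algebraMap K R r := by
    intro r; simp [ψ, φ]
  let S : Set R := (fun l : List I => (l.map y).prod) '' {l | l.length ≤ Fintype.card I}
  have hS : S.Finite := (List.finite_length_le I _).image _
  have hw : ∀ (m : ℕ) (l : List I), l.length = m →
      (l.map y).prod ∈ Submodule.span (MvPolynomial I K) S := by
    intro m
    induction m using Nat.strong_induction_on with
    | _ m ih =>
      intro l hl
      by_cases hle : l.length ≤ Fintype.card I
      · exact Submodule.subset_span ⟨l, hle, rfl⟩
      · have hnd : ¬ l.Nodup := fun hn => hle hn.length_le_card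
        obtain ⟨s, l1, l2, l3, rfl⟩ := fkAux_split l hnd
        obtain ⟨l2', h2, h3⟩ := fkAux_move y act h s l2
        have key := ih (l1 ++ (l2' ++ l3)).length
          (by rw [← hl]; simp; omega) _ rfl
        have key2 := Submodule.smul_mem _ (MvPolynomial.X s : MvPolynomial I K) key
        have e : (MvPolynomial.X s : MvPolynomial I K) • ((l1 ++ (l2' ++ l3)).map y).prod
            = (l1.map y).prod * (y s * ((y s * (l2'.map y).prod) * (l3.map y).prod)) := by
          rw [hsm, List.map_append, List.prod_append, ← mul_assoc, hψ, hX]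
          simp [mul_assoc]
        rw [e] at key2
        have e2 : ((l1 ++ s :: (l2 ++ s :: l3)).map y).prod
            = (l1.map y).prod * (y s * (((l2.map y).prod * y s) * (l3.map y).prod)) := by
          simp [mul_assoc]
        rw [e2]
        rcases h3 with h3 | h3
        · rw [h3]; exact key2
        · rw [h3]
          simpa only [neg_mul, mul_neg] using Submodule.neg_mem _ key2
  have hspan : Submodule.span (MvPolynomial I K) S = ⊤ := by
    rw [eq_top_iff]
    intro x _
    have hx : x ∈ Subalgebra.toSubmodule (Algebra.adjoin K (Set.range y)) := by
      rw [htop]; trivial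
    rw [Algebra.adjoin_eq_span] at hx
    induction hx using Submodule.span_induction with
    | mem x hx =>
      obtain ⟨l, hl, rfl⟩ := Submonoid.exists_list_of_mem_closure hx
      obtain ⟨l', rfl⟩ : ∃ l' : List I, l'.map y = l := by
        have : l ∈ Set.range (List.map y) := by
          rw [Set.range_list_map]; exact hl
        exact this
      exact hw _ l' rfl
    | zero => exact Submodule.zero_mem _
    | add a b _ _ ha hb => exact Submodule.add_mem _ (ha trivial) (hb trivial)
    | smul r a _ ha =>
      have := Submodule.smul_mem _ (MvPolynomial.C r : MvPolynomial I K) (ha trivial)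
      rwa [hsm, hC, ← Algebra.smul_def] at this
  have : Module.Finite (MvPolynomial I K) R :=
    ⟨⟨hS.toFinset, by rw [Set.Finite.coe_toFinset]; exact hspan⟩⟩
  have : Module.Finite (MvPolynomial I K) Rᵐᵒᵖ :=
    Module.Finite.equiv (MulOpposite.opLinearEquiv (MvPolynomial I K))
  exact ⟨IsNoetherianRing.of_finite (MvPolynomial I K) R,
    IsNoetherianRing.of_finite (MvPolynomial I K) Rᵐᵒᵖ⟩

end fkAux

theorem fkAux_Ygen_neg (n : ℕ) (i j : Fin n) : Ygen k n j i = - Ygen k n i j := by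
  unfold Ygen
  rcases lt_trichotomy i j with h | h | h
  · simp [h, h.not_gt]
  · subst h; simp
  · simp [h, h.not_gt]

theorem fkAux_disj {R : Type} [Ring R] {n : ℕ} (Y : Fin n → Fin n → R)
    (hneg : ∀ i j, Y j i = - Y i j) (hself : ∀ i, Y i i = 0)
    (htri : ∀ i j l, i ≠ j → j ≠ l → i ≠ l → Y i j * Y j l = - (Y j l * Y i l))
    (hdisj : ∀ i j s t, i < j → s < t → i ≠ s → i ≠ t → j ≠ s → j ≠ t →
      Y i j * Y s t = - (Y s t * Y i j))
    (i j s t : Fin n)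
    (h1 : i ≠ s) (h2 : i ≠ t) (h3 : j ≠ s) (h4 : j ≠ t) :
    Y i j * Y s t = - (Y s t * Y i j) := by
  have base := hdisj
  rcases lt_trichotomy i j with h | h | h <;> rcases lt_trichotomy s t with h' | h' | h'
  · exact base i j s t h h' h1 h2 h3 h4
  · subst h'; simp [hself]
  · have := base i j t s h h' h2 h1 h4 h3
    rw [hneg t s]; simp [this]
  · subst h; simp [hself]
  · subst h; simp [hself]
  · subst h; simp [hself]
  · have := base j i s t h h' h3 h4 h1 h2
    rw [hneg j i]; simp [this]
  · subst h'; simp [hself]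
  · have := base j i t s h h' h4 h3 h2 h1
    rw [hneg j i, hneg t s]; simp [this]

theorem fkAux_rel {R : Type} [Ring R] {n : ℕ} (Y : Fin n → Fin n → R)
    (hneg : ∀ i j, Y j i = - Y i j) (hself : ∀ i, Y i i = 0)
    (htri : ∀ i j l, i ≠ j → j ≠ l → i ≠ l → Y i j * Y j l = - (Y j l * Y i l))
    (hdisj : ∀ i j s t, i < j → s < t → i ≠ s → i ≠ t → j ≠ s → j ≠ t →
      Y i j * Y s t = - (Y s t * Y i j))
    (i j s t : Fin n) :
    Y i j * Y s t
      = - (Y s t * Y (Equiv.swap s t i) (Equiv.swap s t j)) := by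
  by_cases hij : i = j
  · subst hij; simp [hself]
  by_cases hst : s = t
  · subst hst; simp [hself]
  by_cases h1 : i = s
  · subst h1
    by_cases h4 : j = t
    · subst h4
      rw [Equiv.swap_apply_left, Equiv.swap_apply_right, hneg i j]; simp
    · rw [Equiv.swap_apply_left, Equiv.swap_apply_of_ne_of_ne (Ne.symm hij) h4,
        hneg j i, neg_mul,
        htri j i t (Ne.symm hij) hst h4, hneg j t]
      simp
  by_cases h2 : i = t
  · subst h2
    by_cases h3 : j = s
    · subst h3
      rw [Equiv.swap_apply_left, Equiv.swap_apply_right, hneg j i]; simp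
    · rw [Equiv.swap_apply_right, Equiv.swap_apply_of_ne_of_ne h3 (Ne.symm hij),
        hneg j i, hneg i s, neg_mul_neg,
        htri j i s (Ne.symm hij) h1 h3, hneg j s]
      simp
  by_cases h3 : j = s
  · subst h3
    rw [Equiv.swap_apply_left, Equiv.swap_apply_of_ne_of_ne h1 h2,
      htri i j t hij hst h2]
  by_cases h4 : j = t
  · subst h4
    rw [Equiv.swap_apply_right, Equiv.swap_apply_of_ne_of_ne h1 h2,
      hneg j s, mul_neg, htri i j s hij h3 h1]
    simp
  rw [Equiv.swap_apply_of_ne_of_ne h1 h2, Equiv.swap_apply_of_ne_of_ne h3 h4]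
  exact fkAux_disj Y hneg hself htri hdisj i j s t h1 h2 h3 h4

theorem fkAux_top (n : ℕ) :
    Algebra.adjoin k (Set.range (fun p : Fin n × Fin n => yy k n p.1 p.2)) = ⊤ := by
  rw [eq_top_iff]
  intro x _
  obtain ⟨a, rfl⟩ := RingQuot.mkAlgHom_surjective k (FKRel k n) x
  induction a using FreeAlgebra.induction with
  | grade0 r => rw [AlgHom.commutes]; exact Subalgebra.algebraMap_mem _ r
  | grade1 p =>
    refine Algebra.subset_adjoin ⟨p.1, ?_⟩
    have hp := p.2
    simp only [yy, Ygen]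
    rw [dif_pos hp]
  | mul a b ha hb => rw [map_mul]; exact mul_mem (ha trivial) (hb trivial)
  | add a b ha hb => rw [map_add]; exact add_mem (ha trivial) (hb trivial)

/-- For every `n ≥ 2`, the algebra `E_n^!` is Noetherian
(both left and right Noetherian). -/
theorem FKDual_isNoetherianRing (n : ℕ) (hn : 2 ≤ n) :
    IsNoetherianRing (FKDual k n) ∧ IsNoetherianRing (FKDual k n)ᵐᵒᵖ := by
  exact fkAux_noeth (K := k) (fun p : Fin n × Fin n => yy k n p.1 p.2)
    (fun q p => (Equiv.swap q.1 q.2 p.1, Equiv.swap q.1 q.2 p.2))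
    (fun p q => fkAux_rel (yy k n)
      (fun i j => by
        unfold yy
        rw [fkAux_Ygen_neg k n i j]
        exact map_neg (RingQuot.mkAlgHom k (FKRel k n)) _)
      (fun i => by simp [yy, Ygen])
      (fun i j l hij hjl hil => by
        have := RingQuot.mkAlgHom_rel k (FKRel.triple (k := k) i j l hij hjl hil)
        rw [map_add, map_mul, map_mul, map_zero] at this
        exact eq_neg_of_add_eq_zero_left this)
      (fun i j s t hij hst h1 h2 h3 h4 => by
        have := RingQuot.mkAlgHom_rel k (FKRel.disj (k := k) i j s t hij hst h1 h2 h3 h4)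
        rw [map_add, map_mul, map_mul, map_zero] at this
        exact eq_neg_of_add_eq_zero_left this)
      p.1 p.2 q.1 q.2) (fun p q => by simp) (fkAux_top k n)

end
end

section
/- For every integer n ≥ 2, the algebra E_n^! is a finitely generated module over its center. -/
/- The quadratic dual Fomin–Kirillov algebra `E_n^!` over an algebraically
closed field `k` of characteristic zero, presented as a quotient of the free
algebra on generators `y_{i,j}` (for `1 ≤ i < j ≤ n`, realized here with
`0`-based indexing by the subtype of pairs `(i,j) : Fin n × Fin n` with `i < j`),
with the convention `y_{j,i} = -y_{i,j}`. -/

noncomputable section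

variable (k : Type) [Field k] [IsAlgClosed k] [CharZero k]

set_option linter.unusedSectionVars false

theorem eq_smul_of_add_zero {A : Type} [Semiring A] [Algebra k A] {a b : A} (h : a + b = 0) :
    a = (-1 : k) • b := by
  have h2 : b + (-1 : k) • b = 0 := by
    have : (1 : k) • b + (-1 : k) • b = 0 := by rw [← add_smul]; simp
    simpa using this
  calc a = a + (b + (-1 : k) • b) := by rw [h2, add_zero]
    _ = (-1 : k) • b := by rw [← add_assoc, h, zero_add]

theorem neg1_smul_smul {A : Type} [Semiring A] [Algebra k A] (a : A) :
    (-1 : k) • (-1 : k) • a = a := by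
  rw [smul_smul]; simp

theorem yy_symm (n : ℕ) (i j : Fin n) : yy k n j i = (-1 : k) • yy k n i j := by
  unfold yy
  apply eq_smul_of_add_zero
  rw [← map_add]
  have : Ygen k n j i + Ygen k n i j = 0 := by
    unfold Ygen
    rcases lt_trichotomy i j with h | h | h
    · simp only [h, h.not_gt, dite_true, dite_false]
      exact neg_add_cancel _
    · subst h; simp
    · simp only [h, h.not_gt, dite_true, dite_false]
      exact add_neg_cancel _
  rw [this, map_zero]

theorem yy_triple (n : ℕ) (i j l : Fin n) (hij : i ≠ j) (hjl : j ≠ l) (hil : i ≠ l) :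
    yy k n i j * yy k n j l = (-1 : k) • (yy k n j l * yy k n i l) := by
  have h := RingQuot.mkAlgHom_rel k (FKRel.triple (k := k) i j l hij hjl hil)
  simp only [map_add, map_mul, map_zero] at h
  exact eq_smul_of_add_zero k h

theorem yy_disj_lt (n : ℕ) (i j s t : Fin n) (hij : i < j) (hst : s < t)
    (h1 : i ≠ s) (h2 : i ≠ t) (h3 : j ≠ s) (h4 : j ≠ t) :
    yy k n i j * yy k n s t = (-1 : k) • (yy k n s t * yy k n i j) := by
  have h := RingQuot.mkAlgHom_rel k (FKRel.disj (k := k) i j s t hij hst h1 h2 h3 h4)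
  simp only [map_add, map_mul, map_zero] at h
  exact eq_smul_of_add_zero k h

/-- The generator attached to an index. -/
def gg (n : ℕ) (s : FKIdx n) : FKDual k n := yy k n s.1.1 s.1.2

theorem yy_eq_gg (n : ℕ) (i j : Fin n) (h : i ≠ j) :
    ∃ (s : FKIdx n) (c : k), yy k n i j = c • gg k n s := by
  rcases lt_or_gt_of_ne h with h | h
  · exact ⟨⟨(i, j), h⟩, 1, by simp [gg]⟩
  · exact ⟨⟨(j, i), h⟩, -1, yy_symm k n j i⟩

theorem yy_move (n : ℕ) (i j l : Fin n) (hij : i ≠ j) (hjl : j ≠ l) (hil : i ≠ l) :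
    ∃ (s : FKIdx n) (c : k), yy k n i j * yy k n j l = c • (yy k n j l * gg k n s) := by
  obtain ⟨s, c, h⟩ := yy_eq_gg k n i l hil
  refine ⟨s, -1 * c, ?_⟩
  rw [yy_triple k n i j l hij hjl hil, h, mul_smul_comm, smul_smul]

theorem anti_sq {A : Type} [Semiring A] [Algebra k A] (x x' t : A)
    (h1 : x * t = (-1 : k) • (t * x')) (h2 : x' * t = (-1 : k) • (t * x)) :
    x * (t * t) = (t * t) * x := by
  rw [← mul_assoc, h1, smul_mul_assoc, mul_assoc, h2, mul_smul_comm, neg1_smul_smul, mul_assoc]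

theorem yy_sq (n : ℕ) (i j l : Fin n) (hij : i ≠ j) (hjl : j ≠ l) (hil : i ≠ l) :
    yy k n i j * (yy k n j l * yy k n j l) = (yy k n j l * yy k n j l) * yy k n i j := by
  refine anti_sq k _ _ _ (yy_triple k n i j l hij hjl hil) ?_
  have h2 := yy_triple k n i l j hil hjl.symm hij
  rw [yy_symm k n l j, mul_smul_comm, h2, smul_mul_assoc]

theorem gg_pair (n : ℕ) (s t : FKIdx n) :
    (∃ (s' : FKIdx n) (c : k), gg k n s * gg k n t = c • (gg k n t * gg k n s')) ∧
    gg k n s * (gg k n t * gg k n t) = (gg k n t * gg k n t) * gg k n s := by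
  obtain ⟨⟨a, b⟩, hab⟩ := s
  obtain ⟨⟨c, d⟩, hcd⟩ := t
  simp only at hab hcd
  have gen : ∀ i j l : Fin n, i ≠ j → j ≠ l → i ≠ l →
      (∃ e : k, yy k n a b = e • yy k n i j) →
      (∃ e : k, yy k n c d = e • yy k n j l) →
      (∃ (s' : FKIdx n) (e : k), yy k n a b * yy k n c d = e • (yy k n c d * gg k n s')) ∧
      yy k n a b * (yy k n c d * yy k n c d) = (yy k n c d * yy k n c d) * yy k n a b := by
    rintro i j l hij hjl hil ⟨e1, h1⟩ ⟨e2, h2⟩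
    obtain ⟨s, e, h⟩ := yy_move k n i j l hij hjl hil
    have hs := yy_sq k n i j l hij hjl hil
    rw [h1, h2]
    constructor
    · refine ⟨s, e1 * e, ?_⟩
      simp only [smul_mul_assoc, mul_smul_comm, h, smul_smul]
      congr 1
      ring
    · simp only [smul_mul_assoc, mul_smul_comm, hs, smul_smul]
      congr 1
      ring
  have one : ∀ x : FKDual k n, ∃ e : k, x = e • x := fun x => ⟨1, (one_smul k x).symm⟩
  unfold gg
  simp only
  by_cases hac : a = c
  · by_cases hbd : b = d
    · subst hac hbd
      exact ⟨⟨⟨(a, b), hab⟩, 1, (one_smul k _).symm⟩, by rw [mul_assoc]⟩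
    · subst hac
      exact gen b a d hab.ne' hcd.ne hbd ⟨_, yy_symm k n b a⟩ (one _)
  by_cases hbd : b = d
  · subst hbd
    exact gen a b c hab.ne hcd.ne' hac (one _) ⟨_, yy_symm k n b c⟩
  by_cases hbc : b = c
  · subst hbc
    exact gen a b d hab.ne hcd.ne (hab.trans hcd).ne (one _) (one _)
  by_cases had : a = d
  · subst had
    exact gen b a c hab.ne' hcd.ne' hbc ⟨_, yy_symm k n b a⟩ ⟨_, yy_symm k n a c⟩
  have h := yy_disj_lt k n a b c d hab hcd hac had hbc hbd
  exact ⟨⟨⟨(a, b), hab⟩, -1, h⟩, anti_sq k _ _ _ h h⟩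

theorem mk_ι (n : ℕ) (s : FKIdx n) :
    RingQuot.mkAlgHom k (FKRel k n) (FreeAlgebra.ι k s) = gg k n s := by
  obtain ⟨⟨a, b⟩, hab⟩ := s
  simp only at hab
  simp [gg, yy, Ygen, hab]

theorem FK_adjoin (n : ℕ) : Algebra.adjoin k (Set.range (gg k n)) = ⊤ := by
  have h : (Algebra.adjoin k (Set.range (FreeAlgebra.ι k (X := FKIdx n)))).map
      (RingQuot.mkAlgHom k (FKRel k n)) = ⊤ := by
    rw [FreeAlgebra.adjoin_range_ι, Algebra.map_top, AlgHom.range_eq_top]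
    exact RingQuot.mkAlgHom_surjective k (FKRel k n)
  rw [AlgHom.map_adjoin, ← Set.range_comp] at h
  rw [← h]
  congr 2
  funext s
  exact (mk_ι k n s).symm

theorem gg_sq_central (n : ℕ) (t : FKIdx n) :
    gg k n t * gg k n t ∈ Subalgebra.center k (FKDual k n) := by
  rw [Subalgebra.mem_center_iff]
  intro b
  have hb : b ∈ Algebra.adjoin k (Set.range (gg k n)) := by rw [FK_adjoin]; trivial
  induction hb using Algebra.adjoin_induction with
  | mem x hx =>
    obtain ⟨s, rfl⟩ := hx
    exact (gg_pair k n s t).2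
  | algebraMap r => exact Algebra.commutes r _
  | add x y _ _ hx hy => rw [add_mul, mul_add, hx, hy]
  | mul x y _ _ hx hy => rw [mul_assoc, hy, ← mul_assoc, hx, mul_assoc]

theorem list_move (n : ℕ) (t : FKIdx n) (v : List (FKIdx n)) :
    ∃ (v' : List (FKIdx n)) (c : k), v'.length = v.length ∧
      (v.map (gg k n)).prod * gg k n t = c • (gg k n t * (v'.map (gg k n)).prod) := by
  induction v with
  | nil => exact ⟨[], 1, rfl, by simp⟩
  | cons s v ih =>
    obtain ⟨v', c, hl, h⟩ := ih
    obtain ⟨s', e, hs⟩ := (gg_pair k n s t).1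
    refine ⟨s' :: v', c * e, by simp [hl], ?_⟩
    simp only [List.map_cons, List.prod_cons]
    rw [mul_assoc, h, mul_smul_comm, ← mul_assoc, hs, smul_mul_assoc, smul_smul, mul_assoc]

theorem exists_dup {α : Type} (l : List α) (h : ¬ l.Nodup) :
    ∃ (t : α) (u v w : List α), l = u ++ t :: (v ++ t :: w) := by
  induction l with
  | nil => simp at h
  | cons a l ih =>
    by_cases ha : a ∈ l
    · obtain ⟨v, w, rfl⟩ := List.append_of_mem ha
      exact ⟨a, [], v, w, rfl⟩
    · have h' : ¬ l.Nodup := fun hl => h (List.nodup_cons.2 ⟨ha, hl⟩)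
      obtain ⟨t, u, v, w, rfl⟩ := ih h'
      exact ⟨t, a :: u, v, w, rfl⟩

theorem list_mem_span (n : ℕ) (m : ℕ) : ∀ l : List (FKIdx n), l.length = m →
    (l.map (gg k n)).prod ∈ Submodule.span (Subalgebra.center k (FKDual k n))
      ((fun l : List (FKIdx n) => (l.map (gg k n)).prod) '' {l | l.Nodup}) := by
  induction m using Nat.strong_induction_on with
  | _ m ih =>
    intro l hl
    by_cases hd : l.Nodup
    · exact Submodule.subset_span ⟨l, hd, rfl⟩
    obtain ⟨t, u, v, w, rfl⟩ := exists_dup l hd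
    obtain ⟨v', c, hv, h⟩ := list_move k n t v
    have hc := gg_sq_central k n t
    have hmem := ih (u ++ (v' ++ w)).length (by simp [hv] at hl ⊢; omega) _ rfl
    have hz := Submodule.smul_mem _ (c • (⟨_, hc⟩ : Subalgebra.center k (FKDual k n))) hmem
    convert hz using 1
    rw [Subalgebra.smul_def]
    have hcu := Subalgebra.mem_center_iff.1 hc (u.map (gg k n)).prod
    simp only [List.map_append, List.prod_append, List.map_cons, List.prod_cons,
      SetLike.val_smul, smul_eq_mul, smul_mul_assoc]
    rw [← mul_assoc (v.map (gg k n)).prod, h]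
    simp only [smul_mul_assoc, mul_smul_comm]
    congr 1
    rw [← mul_assoc (gg k n t * gg k n t), ← hcu]
    simp only [mul_assoc]

theorem finite_nodup (α : Type) [Fintype α] : {l : List α | l.Nodup}.Finite :=
  (List.finite_length_le α (Fintype.card α)).subset fun _ hl => List.Nodup.length_le_card hl

/-- For every `n ≥ 2`, the algebra `E_n^!` is a finitely
generated module over its center. -/
theorem FKDual_finite_over_center (n : ℕ) (hn : 2 ≤ n) :
    Module.Finite (Subalgebra.center k (FKDual k n)) (FKDual k n) := by
  refine Module.Finite.of_fg_top (Submodule.fg_def.2 ⟨_, (finite_nodup (FKIdx n)).image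
    (fun l : List (FKIdx n) => (l.map (gg k n)).prod), ?_⟩)
  rw [eq_top_iff]
  rintro x -
  have hx : x ∈ Subalgebra.toSubmodule (Algebra.adjoin k (Set.range (gg k n))) := by
    rw [FK_adjoin]; trivial
  rw [Algebra.adjoin_eq_span] at hx
  induction hx using Submodule.span_induction with
  | mem x hx =>
    obtain ⟨l, hl, rfl⟩ := Submonoid.exists_list_of_mem_closure hx
    have : Nonempty (FKIdx n) := ⟨⟨(⟨0, by omega⟩, ⟨1, by omega⟩), by simp⟩⟩
    choose! f hf using hl
    have : l = (l.map f).map (gg k n) := by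
      rw [List.map_map]
      exact (List.map_id l).symm.trans (List.map_congr_left fun y hy => (hf y hy).symm)
    rw [this]
    exact list_mem_span k n _ _ rfl
  | zero => exact Submodule.zero_mem _
  | add x y _ _ hx hy => exact Submodule.add_mem _ hx hy
  | smul c x _ hx =>
    have := Submodule.smul_mem _ (algebraMap k (Subalgebra.center k (FKDual k n)) c) hx
    rwa [algebraMap_smul] at this

end
end

section
/- Set a_{i,j} := y_{i,j}^2 in E_n^! (with a_{j,i} := a_{i,j}). Then for all pairwise distinct indices i, j, k in {1,…,n}, the following relations hold in E_n^!: a_{i,j} y_{j,k} = y_{j,k} a_{i,k} and a_{i,j} a_{j,k} = a_{i,j} a_{i,k}. -/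
/- The quadratic dual Fomin–Kirillov algebra `E_n^!` over an algebraically
closed field `k` of characteristic zero, presented as a quotient of the free
algebra on generators `y_{i,j}` (for `1 ≤ i < j ≤ n`, realized here with
`0`-based indexing by the subtype of pairs `(i,j) : Fin n × Fin n` with `i < j`),
with the convention `y_{j,i} = -y_{i,j}`. -/

noncomputable section

variable (k : Type) [Field k] [IsAlgClosed k] [CharZero k]

theorem ring_first_aux {R : Type*} [Ring R] (x y z : R) (h : x * y + y * z = 0) :
    x ^ 2 * y = y * z ^ 2 := by
  have h' : x * y = - (y * z) := eq_neg_of_add_eq_zero_left h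
  rw [pow_two, pow_two, mul_assoc, h', mul_neg, ← mul_assoc, h', neg_mul, neg_neg, mul_assoc]

/-- Here `x = y_{ij}`, `y = y_{jl}`, `z = y_{il}`, `x' = y_{ji}`, `z' = y_{li}`. -/
theorem ring_second_aux {R : Type*} [Ring R] (x y z x' z' : R)
    (hx : x' + x = 0) (hz : z' + z = 0)
    (h1 : x * y + y * z = 0) (h2 : x' * z + z * y = 0) (h3 : y * z' + z' * x' = 0) :
    x ^ 2 * y ^ 2 = x ^ 2 * z ^ 2 := by
  obtain rfl : x' = -x := eq_neg_of_add_eq_zero_left hx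
  obtain rfl : z' = -z := eq_neg_of_add_eq_zero_left hz
  have e1 : x * y = - (y * z) := eq_neg_of_add_eq_zero_left h1
  have e2 : x * z = z * y := by
    rw [neg_mul, neg_add_eq_zero] at h2
    exact h2
  have e3 : y * z = z * x := by
    rw [mul_neg, neg_mul_neg, neg_add_eq_zero] at h3
    exact h3
  calc x ^ 2 * y ^ 2 = x * (x * y) * y := by noncomm_ring
    _ = x * (-(z * x)) * y := by rw [e1, e3]
    _ = - ((x * z) * (x * y)) := by noncomm_ring
    _ = (z * y) * (y * z) := by rw [e1, e2]; noncomm_ring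
    _ = (x * z) * (y * z) := by rw [e2]
    _ = x * (z * y) * z := by noncomm_ring
    _ = x * (x * z) * z := by rw [e2]
    _ = x ^ 2 * z ^ 2 := by noncomm_ring

theorem yy_swap_aux (n : ℕ) (i j : Fin n) : yy k n j i + yy k n i j = 0 := by
  unfold yy
  rw [← map_add]
  have : Ygen k n j i + Ygen k n i j = 0 := by
    unfold Ygen
    rcases lt_trichotomy i j with h | h | h
    · simp [h, not_lt.mpr h.le]
    · subst h; simp
    · simp [h, not_lt.mpr h.le]
  rw [this, map_zero]

theorem yy_triple_aux (n : ℕ) (i j l : Fin n) (hij : i ≠ j) (hjl : j ≠ l) (hil : i ≠ l) :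
    yy k n i j * yy k n j l + yy k n j l * yy k n i l = 0 := by
  have h := RingQuot.mkAlgHom_rel k (FKRel.triple (k := k) i j l hij hjl hil)
  rw [map_add, map_mul, map_mul, map_zero] at h
  exact h

/-- with `a_{i,j} := y_{i,j}^2` (and `a_{j,i} = a_{i,j}`, which
holds automatically since `y_{j,i} = -y_{i,j}`), for all pairwise distinct
`i, j, l` one has `a_{i,j} y_{j,l} = y_{j,l} a_{i,l}` and
`a_{i,j} a_{j,l} = a_{i,j} a_{i,l}` in `E_n^!`. -/
theorem FKDual_a_relations (n : ℕ) (hn : 2 ≤ n) (i j l : Fin n)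
    (hij : i ≠ j) (hjl : j ≠ l) (hil : i ≠ l) :
    (yy k n i j) ^ 2 * yy k n j l = yy k n j l * (yy k n i l) ^ 2 ∧
    (yy k n i j) ^ 2 * (yy k n j l) ^ 2 = (yy k n i j) ^ 2 * (yy k n i l) ^ 2 := by
  exact ⟨ring_first_aux _ _ _ (yy_triple_aux k n i j l hij hjl hil),
    ring_second_aux _ _ _ _ _ (yy_swap_aux k n i j) (yy_swap_aux k n i l)
      (yy_triple_aux k n i j l hij hjl hil) (yy_triple_aux k n j i l hij.symm hil hjl)
      (yy_triple_aux k n j l i hjl hil.symm hij.symm)⟩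

end
end

section
/- Let C_n be the subalgebra of E_n^! generated by the central elements a_{i,j} := y_{i,j}^2 for 1 ≤ i < j ≤ n. Then E_n^! is a finitely generated C_n-module; in fact, E_n^! is spanned over C_n by the finitely many monomials y_{1,2}^{e_{1,2}} y_{1,3}^{e_{1,3}} ⋯ y_{n-1,n}^{e_{n-1,n}} with all exponents e_{i,j} ∈ {0,1}. -/
/- The quadratic dual Fomin–Kirillov algebra `E_n^!` over an algebraically
closed field `k` of characteristic zero, presented as a quotient of the free
algebra on generators `y_{i,j}` (for `1 ≤ i < j ≤ n`, realized here with
`0`-based indexing by the subtype of pairs `(i,j) : Fin n × Fin n` with `i < j`),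
with the convention `y_{j,i} = -y_{i,j}`. -/

noncomputable section

variable (k : Type) [Field k] [IsAlgClosed k] [CharZero k]

/-- The list of ordered index pairs `(i,j)` with `i < j`, in the order
`(1,2), (1,3), (2,3), (1,4), (2,4), (3,4), …, (n-1,n)`. -/
def pairList (n : ℕ) : List (Fin n × Fin n) :=
  (List.finRange n).flatMap fun j =>
    ((List.finRange n).filter fun i => decide (i < j)).map fun i => (i, j)

/-- The subalgebra `C_n` of `E_n^!` generated by the central elements
`a_{i,j} = y_{i,j}^2` for `i < j`. -/
def Csub (n : ℕ) : Subalgebra k (FKDual k n) :=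
  Algebra.adjoin k {z : FKDual k n | ∃ i j : Fin n, i < j ∧ z = (yy k n i j) ^ 2}

section helpers

/-- Ordering key of a pair: larger index first. -/
def fkKey (n : ℕ) (p : Fin n × Fin n) : Fin n ×ₗ Fin n := toLex (p.2, p.1)

lemma fk_straighten {A ι O : Type} [Ring A] [LinearOrder O] [WellFoundedLT O]
    (C : Type) [Ring C] [Module C A] [SMulCommClass C A A] [IsScalarTower C A A]
    (key : ι → O) (hinj : Function.Injective key) (y : ι → A)
    (hsq : ∀ p, ∃ c : C, ∀ u : A, y p * (y p * u) = c • u)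
    (hre : ∀ p q, key q < key p → ∃ p' q', key p' < key p ∧ y p * y q = - (y p' * y q')) :
    ∀ m : ℕ, (∀ w : List ι, w.length ≤ m → (w.map y).prod ∈ Submodule.span C
      {u : A | ∃ s : List ι, s.length ≤ m ∧ s.Pairwise (fun p q => key p < key q) ∧
        u = (s.map y).prod}) ∧
      (∀ x : ι, ∀ u ∈ Submodule.span C
      {u : A | ∃ s : List ι, s.length ≤ m ∧ s.Pairwise (fun p q => key p < key q) ∧
        u = (s.map y).prod}, y x * u ∈ Submodule.span C
      {u : A | ∃ s : List ι, s.length ≤ m + 1 ∧ s.Pairwise (fun p q => key p < key q) ∧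
        u = (s.map y).prod}) := by
  have step : ∀ m : ℕ, (∀ w : List ι, w.length ≤ m → (w.map y).prod ∈ Submodule.span C
      {u : A | ∃ s : List ι, s.length ≤ m ∧ s.Pairwise (fun p q => key p < key q) ∧
        u = (s.map y).prod}) → 
      (∀ x : ι, ∀ u ∈ Submodule.span C
      {u : A | ∃ s : List ι, s.length ≤ m ∧ s.Pairwise (fun p q => key p < key q) ∧
        u = (s.map y).prod}, y x * u ∈ Submodule.span C
      {u : A | ∃ s : List ι, s.length ≤ m + 1 ∧ s.Pairwise (fun p q => key p < key q) ∧
        u = (s.map y).prod}) := by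
    intro m hm x
    induction hk : key x using WellFoundedLT.induction generalizing x with
    | ind o ih =>
    subst hk
    intro u hu
    induction hu using Submodule.span_induction with
    | zero => simp
    | add a b _ _ ha hb => rw [mul_add]; exact add_mem ha hb
    | smul c a _ ha => rw [mul_smul_comm]; exact Submodule.smul_mem _ _ ha
    | mem u hu =>
      obtain ⟨s, hs, hp, rfl⟩ := hu
      cases s with
      | nil => exact Submodule.subset_span ⟨[x], by simp, by simp, by simp⟩
      | cons h r =>
        rcases lt_trichotomy (key x) (key h) with hlt | heq | hgt
        · refine Submodule.subset_span ⟨x :: h :: r, by simpa using hs, ?_, by simp⟩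
          refine List.pairwise_cons.2 ⟨?_, hp⟩
          intro a ha
          rcases List.mem_cons.1 ha with rfl | ha
          · exact hlt
          · exact hlt.trans ((List.pairwise_cons.1 hp).1 a ha)
        · obtain rfl := hinj heq
          obtain ⟨c, hc⟩ := hsq x
          rw [List.map_cons, List.prod_cons, hc]
          refine Submodule.smul_mem _ _ (Submodule.subset_span
            ⟨r, ?_, (List.pairwise_cons.1 hp).2, rfl⟩)
          simp at hs; omega
        · obtain ⟨p', q', hlt, e⟩ := hre x h hgt
          rw [List.map_cons, List.prod_cons, ← mul_assoc, e, neg_mul, mul_assoc]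
          have h1 := ih (key p') hlt p' rfl _ (hm (q' :: r) (by simpa using hs))
          rw [List.map_cons, List.prod_cons] at h1
          exact neg_mem h1
  intro m
  induction m with
  | zero =>
    have h0 : ∀ w : List ι, w.length ≤ 0 → (w.map y).prod ∈ Submodule.span C
      {u : A | ∃ s : List ι, s.length ≤ 0 ∧ s.Pairwise (fun p q => key p < key q) ∧
        u = (s.map y).prod} := by
      intro w hw
      have : w = [] := by simpa using hw
      subst this
      exact Submodule.subset_span ⟨[], by simp, by simp, rfl⟩
    exact ⟨h0, step 0 h0⟩
  | succ m ih =>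
    have h0 : ∀ w : List ι, w.length ≤ m + 1 → (w.map y).prod ∈ Submodule.span C
      {u : A | ∃ s : List ι, s.length ≤ m + 1 ∧ s.Pairwise (fun p q => key p < key q) ∧
        u = (s.map y).prod} := by
      intro w hw
      cases w with
      | nil => exact Submodule.subset_span ⟨[], by simp, by simp, rfl⟩
      | cons x t =>
        rw [List.map_cons, List.prod_cons]
        exact ih.2 x _ (ih.1 t (by simpa using hw))
    exact ⟨h0, step _ h0⟩

/-- Indicator exponent of membership in a list. -/
def fkInd {α : Type} [DecidableEq α] (s : List α) (p : α) : ℕ := if p ∈ s then 1 else 0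

lemma fk_prod_filter {α A : Type} [DecidableEq α] [Monoid A] (y : α → A) (s L : List α) :
    (L.map fun p => y p ^ fkInd s p).prod
      = ((L.filter fun p => decide (p ∈ s)).map y).prod := by
  induction L with
  | nil => simp
  | cons a L ih => rw [List.map_cons, List.prod_cons, ih]; by_cases h : a ∈ s <;> simp [h, fkInd]

lemma fk_filter_eq {α : Type} [DecidableEq α] (R : α → α → Prop)
    (hirr : ∀ a, ¬ R a a) (hasym : ∀ a b, R a b → ¬ R b a)
    (s L : List α) (hs : s.Pairwise R) (hL : L.Pairwise R) (hsub : ∀ a ∈ s, a ∈ L) :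
    (L.filter fun p => decide (p ∈ s)) = s := by
  have nd : ∀ l : List α, l.Pairwise R → l.Nodup := fun l hl =>
    List.Pairwise.imp (fun {a b} (h : R a b) (e : a = b) => hirr a (by rw [← e] at h; exact h)) hl
  have hperm : (L.filter fun p => decide (p ∈ s)).Perm s := by
    rw [List.perm_ext_iff_of_nodup ((nd L hL).filter _) (nd s hs)]
    intro a
    simp only [List.mem_filter, decide_eq_true_eq]
    exact ⟨fun h => h.2, fun h => ⟨hsub a h, h⟩⟩
  exact hperm.eq_of_pairwise (fun a b _ _ h1 h2 => absurd h2 (hasym a b h1)) (hL.filter _) hs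

lemma fk_pairList_sorted (n : ℕ) :
    (pairList n).Pairwise (fun p q => fkKey n p < fkKey n q) := by
  unfold pairList
  rw [List.pairwise_flatMap]
  refine ⟨?_, ?_⟩
  · intro j _
    rw [List.pairwise_map]
    refine List.Pairwise.filter _ ((List.pairwise_lt_finRange n).imp ?_)
    intro a b h
    simp [fkKey, Prod.Lex.toLex_lt_toLex, h]
  · refine (List.pairwise_lt_finRange n).imp ?_
    intro a b h x hx z hz
    simp only [List.mem_map, List.mem_filter] at hx hz
    obtain ⟨i, _, rfl⟩ := hx
    obtain ⟨i', _, rfl⟩ := hz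
    simp [fkKey, Prod.Lex.toLex_lt_toLex, h]

lemma fk_mem_pairList (n : ℕ) (p : Fin n × Fin n) (h : p.1 < p.2) : p ∈ pairList n := by
  unfold pairList
  simp only [List.mem_flatMap, List.mem_map, List.mem_filter]
  exact ⟨p.2, List.mem_finRange _, p.1, ⟨List.mem_finRange _, by simpa using h⟩, rfl⟩

lemma ab_sq_comm {A : Type} [Ring A] {n : ℕ} (y : Fin n → Fin n → A)
    (hsw : ∀ i j, y i j = - y j i)
    (htri : ∀ i j l : Fin n, i ≠ j → j ≠ l → i ≠ l → y i j * y j l + y j l * y i l = 0)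
    (i j l : Fin n) (hij : i ≠ j) (hjl : j ≠ l) (hil : i ≠ l) :
    Commute (y i j ^ 2) (y j l) := by
  have e1 : y i j * y j l = - (y i l * y i j) := by
    have := htri l i j hil.symm hij hjl.symm
    rw [hsw l i, hsw l j, neg_mul, mul_neg] at this
    rw [eq_comm, ← sub_eq_zero, ← this]; abel
  have e2 : y i j * y i l = - (y j l * y i j) := by
    have := htri l j i hjl.symm hij.symm hil.symm
    rw [hsw l j, hsw l i, hsw j i, neg_mul_neg, neg_mul_neg] at this
    exact eq_neg_of_add_eq_zero_right this
  change _ * _ = _ * _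
  rw [pow_two, mul_assoc, e1, mul_neg, ← mul_assoc, e2, neg_mul, neg_neg, mul_assoc]

lemma ab_sq_comm_gen {A : Type} [Ring A] {n : ℕ} (y : Fin n → Fin n → A)
    (hsw : ∀ i j, y i j = - y j i)
    (htri : ∀ i j l : Fin n, i ≠ j → j ≠ l → i ≠ l → y i j * y j l + y j l * y i l = 0)
    (hdis : ∀ i j s t : Fin n, i < j → s < t → i ≠ s → i ≠ t → j ≠ s → j ≠ t →
      y i j * y s t + y s t * y i j = 0)
    (p q : FKIdx n) :
    Commute (y p.1.1 p.1.2 ^ 2) (y q.1.1 q.1.2) := by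
  obtain ⟨⟨a, b⟩, hp⟩ := p
  obtain ⟨⟨c, d⟩, hq⟩ := q
  simp only at hp hq ⊢
  have hsq : y a b ^ 2 = y b a ^ 2 := by rw [hsw a b, neg_sq]
  by_cases h1 : a = c
  · subst h1
    by_cases h2 : b = d
    · subst h2; exact (Commute.refl _).pow_left 2
    · rw [hsq]; exact ab_sq_comm y hsw htri b a d hp.ne' hq.ne h2
  · by_cases h2 : b = d
    · subst h2
      rw [hsw c b]
      exact (ab_sq_comm y hsw htri a b c hp.ne hq.ne' h1).neg_right
    · by_cases h3 : b = c
      · subst h3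
        exact ab_sq_comm y hsw htri a b d hp.ne hq.ne (hp.trans hq).ne
      · by_cases h4 : a = d
        · subst h4
          rw [hsq, hsw c a]
          exact (ab_sq_comm y hsw htri b a c hp.ne' hq.ne' (hq.trans hp).ne').neg_right
        · have e := eq_neg_of_add_eq_zero_left (hdis a b c d hp hq h1 h4 h3 h2)
          change _ * _ = _ * _
          rw [pow_two, mul_assoc, e, mul_neg, ← mul_assoc, e, neg_mul, neg_neg, mul_assoc]

lemma ab_rewrite {A : Type} [Ring A] {n : ℕ} (y : Fin n → Fin n → A)
    (hsw : ∀ i j, y i j = - y j i)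
    (htri : ∀ i j l : Fin n, i ≠ j → j ≠ l → i ≠ l → y i j * y j l + y j l * y i l = 0)
    (hdis : ∀ i j s t : Fin n, i < j → s < t → i ≠ s → i ≠ t → j ≠ s → j ≠ t →
      y i j * y s t + y s t * y i j = 0)
    (p q : FKIdx n) (h : fkKey n q.1 < fkKey n p.1) :
    ∃ p' q' : FKIdx n, fkKey n p'.1 < fkKey n p.1 ∧
      y p.1.1 p.1.2 * y q.1.1 q.1.2
        = - (y p'.1.1 p'.1.2 * y q'.1.1 q'.1.2) := by
  obtain ⟨⟨a, b⟩, hp⟩ := p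
  obtain ⟨⟨c, d⟩, hq⟩ := q
  simp only [fkKey, Prod.Lex.toLex_lt_toLex] at hp hq h ⊢
  by_cases h2 : d = b
  · subst h2
    have hca : c < a := by simpa using h
    refine ⟨⟨(c, a), hca⟩, ⟨(a, d), hp⟩, Or.inl hp, ?_⟩
    exact eq_neg_of_add_eq_zero_right (htri c a d hca.ne hp.ne hq.ne)
  · have hdb : d < b := by
      rcases h with h | h
      · exact h
      · exact absurd h.1 h2
    by_cases h1 : a = c
    · subst h1
      refine ⟨⟨(a, d), hq⟩, ⟨(d, b), hdb⟩, Or.inl hdb, ?_⟩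
      have := htri b a d hp.ne' hq.ne hdb.ne'
      rw [hsw b a, hsw b d, neg_mul, mul_neg] at this
      simp only
      rw [eq_comm, ← sub_eq_zero, ← this]; abel
    · by_cases h3 : a = d
      · subst h3
        refine ⟨⟨(c, a), hq⟩, ⟨(c, b), hq.trans hp⟩, Or.inl hp, ?_⟩
        have := htri b a c hp.ne' hq.ne' (hq.trans hp).ne'
        rw [hsw b a, hsw b c, hsw a c, neg_mul_neg, neg_mul_neg] at this
        exact eq_neg_of_add_eq_zero_left this
      · refine ⟨⟨(c, d), hq⟩, ⟨(a, b), hp⟩, Or.inl hdb, ?_⟩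
        exact eq_neg_of_add_eq_zero_left (hdis a b c d hp hq h1 h3
          (hq.trans hdb).ne' (Ne.symm h2))

variable {F : Type} [Field F] {n : ℕ}

lemma fk_swap (i j : Fin n) : yy F n i j = - yy F n j i := by
  unfold yy Ygen
  rcases lt_trichotomy i j with h | h | h
  · simp [h, h.not_gt]
  · subst h; simp
  · simp [h, h.not_gt]

lemma fk_triple (i j l : Fin n) (hij : i ≠ j) (hjl : j ≠ l) (hil : i ≠ l) :
    yy F n i j * yy F n j l + yy F n j l * yy F n i l = 0 := by
  have := RingQuot.mkAlgHom_rel F (FKRel.triple (k := F) i j l hij hjl hil)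
  simpa [yy] using this

lemma fk_disj (i j s t : Fin n) (hij : i < j) (hst : s < t)
      (h1 : i ≠ s) (h2 : i ≠ t) (h3 : j ≠ s) (h4 : j ≠ t) :
    yy F n i j * yy F n s t + yy F n s t * yy F n i j = 0 := by
  have := RingQuot.mkAlgHom_rel F (FKRel.disj (k := F) i j s t hij hst h1 h2 h3 h4)
  simpa [yy] using this

lemma fk_sq_comm_gen (p q : FKIdx n) :
    Commute (yy F n p.1.1 p.1.2 ^ 2) (yy F n q.1.1 q.1.2) :=
  ab_sq_comm_gen (yy F n) fk_swap fk_triple fk_disj p q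

lemma fk_rewrite (p q : FKIdx n) (h : fkKey n q.1 < fkKey n p.1) :
    ∃ p' q' : FKIdx n, fkKey n p'.1 < fkKey n p.1 ∧
      yy F n p.1.1 p.1.2 * yy F n q.1.1 q.1.2
        = - (yy F n p'.1.1 p'.1.2 * yy F n q'.1.1 q'.1.2) :=
  ab_rewrite (yy F n) fk_swap fk_triple fk_disj p q h

lemma fk_central (z : FKDual F n)
    (hz : ∀ q : FKIdx n, Commute z (yy F n q.1.1 q.1.2)) (u : FKDual F n) : Commute z u := by
  obtain ⟨a, rfl⟩ := RingQuot.mkAlgHom_surjective F (FKRel F n) u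
  induction a using FreeAlgebra.induction with
  | grade0 r => rw [AlgHom.commutes]; exact (Algebra.commutes r z).symm
  | grade1 q =>
    have := hz q
    have hq := q.2
    simpa [yy, Ygen, hq] using this
  | mul a b ha hb => rw [map_mul]; exact ha.mul_right hb
  | add a b ha hb => rw [map_add]; exact ha.add_right hb

lemma fk_Csub_central (c : FKDual F n) (hc : c ∈ Csub F n) (u : FKDual F n) : Commute c u := by
  have : Csub F n ≤ Subalgebra.center F (FKDual F n) := by
    refine Algebra.adjoin_le ?_
    rintro z ⟨i, j, hij, rfl⟩
    refine Subalgebra.mem_center_iff.2 fun b => ?_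
    exact (fk_central _ (fun q => fk_sq_comm_gen ⟨(i, j), hij⟩ q) b).symm
  exact (Subalgebra.mem_center_iff.1 (this hc) u).symm

lemma fk_mul_mem (S : Submodule (Csub F n) (FKDual F n))
    (hS : ∀ q : FKIdx n, ∀ u ∈ S, yy F n q.1.1 q.1.2 * u ∈ S) (a : FKDual F n) :
    ∀ u ∈ S, a * u ∈ S := by
  obtain ⟨a, rfl⟩ := RingQuot.mkAlgHom_surjective F (FKRel F n) a
  induction a using FreeAlgebra.induction with
  | grade0 r =>
    intro u hu
    rw [AlgHom.commutes]
    exact S.smul_mem (algebraMap F (Csub F n) r) hu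
  | grade1 q =>
    have := hS q
    have hq := q.2
    simpa [yy, Ygen, hq] using this
  | mul a b ha hb => intro u hu; rw [map_mul, mul_assoc]; exact ha _ (hb _ hu)
  | add a b ha hb => intro u hu; rw [map_add, add_mul]; exact add_mem (ha _ hu) (hb _ hu)

lemma fk_span (x : FKDual F n) : x ∈ Submodule.span (Csub F n)
      {m : FKDual F n | ∃ e : Fin n × Fin n → ℕ, (∀ p, e p ≤ 1) ∧
        m = ((pairList n).map fun p => (yy F n p.1 p.2) ^ e p).prod} := by
  classical
  have : SMulCommClass (Csub F n) (FKDual F n) (FKDual F n) := ⟨fun c a b => by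
    change c.1 * (a * b) = a * (c.1 * b)
    rw [← mul_assoc, (fk_Csub_central c.1 c.2 a).eq, mul_assoc]⟩
  have main := fk_straighten (Csub F n) (fun p : FKIdx n => fkKey n p.1)
    (fun p q h => by
      have h' : toLex (p.1.2, p.1.1) = toLex (q.1.2, q.1.1) := h
      have h'' := toLex.injective h'
      exact Subtype.ext (Prod.ext (Prod.ext_iff.1 h'').2 (Prod.ext_iff.1 h'').1))
    (fun p : FKIdx n => yy F n p.1.1 p.1.2)
    (fun p => ⟨⟨yy F n p.1.1 p.1.2 ^ 2, Algebra.subset_adjoin ⟨_, _, p.2, rfl⟩⟩, fun u => by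
      change _ = yy F n p.1.1 p.1.2 ^ 2 * u
      rw [pow_two, mul_assoc]⟩)
    (fun p q h => fk_rewrite p q h)
  have hle : ∀ m, Submodule.span (Csub F n)
      {u : FKDual F n | ∃ s : List (FKIdx n), s.length ≤ m ∧
        s.Pairwise (fun p q => fkKey n p.1 < fkKey n q.1) ∧
        u = (s.map (fun p : FKIdx n => yy F n p.1.1 p.1.2)).prod} ≤
      Submodule.span (Csub F n)
      {m : FKDual F n | ∃ e : Fin n × Fin n → ℕ, (∀ p, e p ≤ 1) ∧
        m = ((pairList n).map fun p => (yy F n p.1 p.2) ^ e p).prod} := by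
    intro m
    refine Submodule.span_mono ?_
    rintro u ⟨s, -, hs, rfl⟩
    refine ⟨fkInd (s.map Subtype.val), fun p => by unfold fkInd; split_ifs <;> simp, ?_⟩
    refine Eq.trans ?_ (fk_prod_filter (fun p : Fin n × Fin n => yy F n p.1 p.2)
      (s.map Subtype.val) (pairList n)).symm
    rw [fk_filter_eq (fun p q => fkKey n p < fkKey n q) (fun a => lt_irrefl _)
        (fun a b h => h.not_gt) _ _ (List.pairwise_map.2 hs) (fk_pairList_sorted n)
        (fun a ha => by
          obtain ⟨q, _, rfl⟩ := List.mem_map.1 ha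
          exact fk_mem_pairList n _ q.2), List.map_map]
    rfl
  have key := fk_mul_mem (Submodule.span (Csub F n)
      {m : FKDual F n | ∃ e : Fin n × Fin n → ℕ, (∀ p, e p ≤ 1) ∧
        m = ((pairList n).map fun p => (yy F n p.1 p.2) ^ e p).prod}) ?_ x 1 ?_
  · simpa using key
  · intro q u hu
    induction hu using Submodule.span_induction with
    | zero => simp
    | add a b _ _ ha hb => rw [mul_add]; exact add_mem ha hb
    | smul c a _ ha => rw [mul_smul_comm]; exact Submodule.smul_mem _ _ ha
    | mem u hu =>
      obtain ⟨e, he, rfl⟩ := hu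
      have hw : ∀ L : List (Fin n × Fin n), (∀ p ∈ L, p.1 < p.2) →
          ∃ w : List (FKIdx n), (L.map fun p => (yy F n p.1 p.2) ^ e p).prod
            = (w.map (fun p : FKIdx n => yy F n p.1.1 p.1.2)).prod := by
        intro L
        induction L with
        | nil => exact fun _ => ⟨[], rfl⟩
        | cons p L ih =>
          intro hL
          obtain ⟨w, hw⟩ := ih (fun p hp => hL p (List.mem_cons_of_mem _ hp))
          refine ⟨List.replicate (e p) ⟨p, hL p List.mem_cons_self⟩ ++ w, ?_⟩
          simp [hw]
      obtain ⟨w, hw⟩ := hw (pairList n) (fun p hp => by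
        simp only [pairList, List.mem_flatMap, List.mem_map, List.mem_filter] at hp
        obtain ⟨j, _, i, hi, rfl⟩ := hp
        simpa using hi.2)
      rw [hw]
      exact hle _ ((main w.length).2 q _ ((main w.length).1 w le_rfl))
  · exact hle 0 (Submodule.subset_span ⟨[], by simp, by simp, by simp⟩)

end helpers

/-- `E_n^!` is a finitely generated module over the subalgebra
`C_n`; in fact it is spanned over `C_n` by the finitely many monomials
`y_{1,2}^{e_{1,2}} ⋯ y_{n-1,n}^{e_{n-1,n}}` with all exponents `e_{i,j} ∈ {0,1}`. -/
theorem FKDual_finite_over_Csub (n : ℕ) (hn : 2 ≤ n) :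
    Module.Finite (Csub k n) (FKDual k n) ∧
    ∀ x : FKDual k n, x ∈ Submodule.span (Csub k n)
      {m : FKDual k n | ∃ e : Fin n × Fin n → ℕ, (∀ p, e p ≤ 1) ∧
        m = ((pairList n).map fun p => (yy k n p.1 p.2) ^ e p).prod} := by
  refine ⟨?_, fk_span⟩
  refine ⟨(Submodule.fg_def).2 ⟨_, ?_, eq_top_iff.2 fun x _ => fk_span x⟩⟩
  refine ((Set.finite_Iic (1 : Fin n × Fin n → ℕ)).image fun e =>
    ((pairList n).map fun p => (yy k n p.1 p.2) ^ e p).prod).subset ?_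
  rintro m ⟨e, he, rfl⟩
  exact ⟨e, he, rfl⟩

end
end

section
/- Let m = ⌊n/2⌋ and I = {(1,2), (3,4), …, (2m−1, 2m)}. Then the quotient algebra B := E_n^! / (y_{i,j} : 1 ≤ i < j ≤ n, (i,j) ∉ I), obtained by factoring out the two-sided ideal generated by all generators y_{i,j} with (i,j) ∉ I, is isomorphic as a k-algebra to the (−1)-skew polynomial ring k_{−1}[z_1, …, z_m] := k⟨z_1, …, z_m⟩/(z_i z_j + z_j z_i : 1 ≤ i < j ≤ m), via z_r ↦ image of y_{2r−1,2r}. -/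
/- The quadratic dual Fomin–Kirillov algebra `E_n^!` over an algebraically
closed field `k` of characteristic zero, presented as a quotient of the free
algebra on generators `y_{i,j}` (for `1 ≤ i < j ≤ n`, realized here with
`0`-based indexing by the subtype of pairs `(i,j) : Fin n × Fin n` with `i < j`),
with the convention `y_{j,i} = -y_{i,j}`. -/

noncomputable section

variable (k : Type) [Field k] [IsAlgClosed k] [CharZero k]

/-- The relations of the `(-1)`-skew polynomial ring
`k_{-1}[z_1, …, z_m] = k⟨z_1,…,z_m⟩/(z_i z_j + z_j z_i : i < j)`. -/
inductive SkewRel (m : ℕ) : FreeAlgebra k (Fin m) → FreeAlgebra k (Fin m) → Prop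
  | anti (i j : Fin m) (h : i < j) :
      SkewRel m (FreeAlgebra.ι k i * FreeAlgebra.ι k j
        + FreeAlgebra.ι k j * FreeAlgebra.ι k i) 0

/-- The `(-1)`-skew polynomial ring `k_{-1}[z_1, …, z_m]`. -/
abbrev SkewPoly (m : ℕ) := RingQuot (SkewRel k m)

/-- The relations defining `B := E_n^! / (y_{i,j} : (i,j) ∉ I)`, where
`I = {(1,2), (3,4), …, (2m-1,2m)}` with `m = ⌊n/2⌋` (in `0`-based indexing,
`I` consists of the pairs `(2r, 2r+1)` for `r < m`). -/
inductive BRel (n : ℕ) : FKDual k n → FKDual k n → Prop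
  | kill (i j : Fin n) (hij : i < j)
      (h : ¬ ∃ r : Fin (n / 2), (i : ℕ) = 2 * (r : ℕ) ∧ (j : ℕ) = 2 * (r : ℕ) + 1) :
      BRel n (yy k n i j) 0

theorem bd0 (n : ℕ) (r : Fin (n / 2)) : 2 * (r : ℕ) < n := by
  have := r.isLt
  omega

theorem bd1 (n : ℕ) (r : Fin (n / 2)) : 2 * (r : ℕ) + 1 < n := by
  have := r.isLt
  omega

/-- Image of the generator `y_{i,j}` in the skew polynomial ring. -/
def Zim (n : ℕ) (i j : Fin n) : SkewPoly k (n / 2) :=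
  if h : (j : ℕ) = i + 1 ∧ (i : ℕ) % 2 = 0 then
    RingQuot.mkAlgHom k (SkewRel k (n / 2))
      (FreeAlgebra.ι k ⟨(i : ℕ) / 2, by have := j.isLt; omega⟩)
  else 0

/-- The lift to the free algebra. -/
def phiFree (n : ℕ) : FreeAlgebra k (FKIdx n) →ₐ[k] SkewPoly k (n / 2) :=
  FreeAlgebra.lift k (fun p : FKIdx n => Zim k n p.1.1 p.1.2)

theorem phiFree_lt (n : ℕ) (i j : Fin n) (h : i < j) :
    phiFree k n (Ygen k n i j) = Zim k n i j := by
  simp [phiFree, Ygen, h]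

theorem phiFree_zero (n : ℕ) (i j : Fin n) (h : (i : ℕ) / 2 ≠ (j : ℕ) / 2) :
    phiFree k n (Ygen k n i j) = 0 := by
  unfold Ygen phiFree
  split_ifs with h1 h2
  · rw [FreeAlgebra.lift_ι_apply]
    exact dif_neg (by dsimp only; omega)
  · rw [map_neg, FreeAlgebra.lift_ι_apply, neg_eq_zero]
    exact dif_neg (by dsimp only; omega)
  · exact map_zero _

theorem skew_anti (m : ℕ) (i j : Fin m) (h : i ≠ j) :
    RingQuot.mkAlgHom k (SkewRel k m) (FreeAlgebra.ι k i) *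
        RingQuot.mkAlgHom k (SkewRel k m) (FreeAlgebra.ι k j) +
      RingQuot.mkAlgHom k (SkewRel k m) (FreeAlgebra.ι k j) *
        RingQuot.mkAlgHom k (SkewRel k m) (FreeAlgebra.ι k i) = 0 := by
  rcases lt_or_gt_of_ne h with h | h
  · simpa using RingQuot.mkAlgHom_rel k (SkewRel.anti (k := k) i j h)
  · rw [add_comm]
    simpa using RingQuot.mkAlgHom_rel k (SkewRel.anti (k := k) j i h)

theorem phiFree_rel (n : ℕ) ⦃x y : FreeAlgebra k (FKIdx n)⦄ (h : FKRel k n x y) :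
    phiFree k n x = phiFree k n y := by
  cases h with
  | triple i j l hij hjl hil =>
    rw [map_add, map_mul, map_mul, map_zero]
    by_cases h1 : (j : ℕ) / 2 = (l : ℕ) / 2
    · have h2 : (i : ℕ) / 2 ≠ (j : ℕ) / 2 := by omega
      have h3 : (i : ℕ) / 2 ≠ (l : ℕ) / 2 := by omega
      rw [phiFree_zero k n i j h2, phiFree_zero k n i l h3, zero_mul, mul_zero, add_zero]
    · rw [phiFree_zero k n j l h1, zero_mul, mul_zero, add_zero]
  | disj i j s t hij hst h1 h2 h3 h4 =>
    rw [map_add, map_mul, map_mul, map_zero, phiFree_lt k n i j hij, phiFree_lt k n s t hst]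
    unfold Zim
    split_ifs with a b
    · exact skew_anti k _ _ _ (by rw [Ne, Fin.mk.injEq]; omega)
    · rw [zero_mul, mul_zero, add_zero]
    · rw [zero_mul, mul_zero, add_zero]
    · rw [zero_mul, add_zero]

/-- The map from `E_n^!`. -/
def phiFK (n : ℕ) : FKDual k n →ₐ[k] SkewPoly k (n / 2) :=
  RingQuot.liftAlgHom k ⟨phiFree k n, phiFree_rel k n⟩

theorem phiFK_yy (n : ℕ) (i j : Fin n) (h : i < j) :
    phiFK k n (yy k n i j) = Zim k n i j := by
  rw [phiFK, yy, RingQuot.liftAlgHom_mkAlgHom_apply, phiFree_lt k n i j h]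

theorem phiFK_rel (n : ℕ) ⦃x y : FKDual k n⦄ (h : BRel k n x y) :
    phiFK k n x = phiFK k n y := by
  cases h with
  | kill i j hij h =>
    rw [phiFK_yy k n i j hij, map_zero]
    refine dif_neg fun h' => h ⟨⟨(i : ℕ) / 2, by have := j.isLt; omega⟩, ?_, ?_⟩
    · dsimp only; omega
    · dsimp only; omega

/-- The map from the quotient `B`. -/
def phiB (n : ℕ) : RingQuot (BRel k n) →ₐ[k] SkewPoly k (n / 2) :=
  RingQuot.liftAlgHom k ⟨phiFK k n, phiFK_rel k n⟩

theorem phiB_mk (n : ℕ) (i j : Fin n) (h : i < j) :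
    phiB k n (RingQuot.mkAlgHom k (BRel k n) (yy k n i j)) = Zim k n i j := by
  rw [phiB, RingQuot.liftAlgHom_mkAlgHom_apply, phiFK_yy k n i j h]

/-- The image of `z_r` in `B`. -/
def yB (n : ℕ) (r : Fin (n / 2)) : RingQuot (BRel k n) :=
  RingQuot.mkAlgHom k (BRel k n)
    (yy k n ⟨2 * (r : ℕ), bd0 n r⟩
      ⟨2 * (r : ℕ) + 1, bd1 n r⟩)

theorem psi_rel (n : ℕ) ⦃x y : FreeAlgebra k (Fin (n / 2))⦄ (h : SkewRel k (n / 2) x y) :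
    FreeAlgebra.lift k (yB k n) x = FreeAlgebra.lift k (yB k n) y := by
  cases h with
  | anti i j h =>
    have hv : (i : ℕ) < j := h
    have h0 := RingQuot.mkAlgHom_rel k (FKRel.disj (k := k) (n := n)
      ⟨2 * (i : ℕ), bd0 n i⟩ ⟨2 * (i : ℕ) + 1, bd1 n i⟩
      ⟨2 * (j : ℕ), bd0 n j⟩ ⟨2 * (j : ℕ) + 1, bd1 n j⟩
      (by rw [Fin.mk_lt_mk]; omega) (by rw [Fin.mk_lt_mk]; omega)
      (by rw [Ne, Fin.mk.injEq]; omega) (by rw [Ne, Fin.mk.injEq]; omega)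
      (by rw [Ne, Fin.mk.injEq]; omega) (by rw [Ne, Fin.mk.injEq]; omega))
    rw [map_add, map_mul, map_mul, map_zero] at h0
    have h1 := congrArg (RingQuot.mkAlgHom k (BRel k n)) h0
    rw [map_add, map_mul, map_mul, map_zero] at h1
    rw [map_add, map_mul, map_mul, map_zero, FreeAlgebra.lift_ι_apply,
      FreeAlgebra.lift_ι_apply]
    exact h1

/-- The map from the skew polynomial ring to `B`. -/
def psiB (n : ℕ) : SkewPoly k (n / 2) →ₐ[k] RingQuot (BRel k n) :=
  RingQuot.liftAlgHom k ⟨FreeAlgebra.lift k (yB k n), psi_rel k n⟩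

theorem psiB_mk (n : ℕ) (r : Fin (n / 2)) :
    psiB k n (RingQuot.mkAlgHom k (SkewRel k (n / 2)) (FreeAlgebra.ι k r)) = yB k n r := by
  rw [psiB, RingQuot.liftAlgHom_mkAlgHom_apply, FreeAlgebra.lift_ι_apply]

theorem phi_psi (n : ℕ) : (phiB k n).comp (psiB k n) = AlgHom.id k _ := by
  apply RingQuot.ringQuot_ext'
  apply FreeAlgebra.hom_ext
  funext r
  change phiB k n (psiB k n (RingQuot.mkAlgHom k (SkewRel k (n / 2)) (FreeAlgebra.ι k r))) =
    RingQuot.mkAlgHom k (SkewRel k (n / 2)) (FreeAlgebra.ι k r)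
  rw [psiB_mk, yB, phiB_mk k n _ _ (by rw [Fin.mk_lt_mk]; omega), Zim,
    dif_pos (by dsimp only; omega)]
  congr 2
  apply Fin.ext
  dsimp only
  omega

theorem psi_Zim (n : ℕ) (i j : Fin n) (h : i < j) :
    psiB k n (Zim k n i j) = RingQuot.mkAlgHom k (BRel k n) (yy k n i j) := by
  unfold Zim
  split_ifs with h'
  · rw [psiB_mk, yB]
    congr 2
    · apply Fin.ext; dsimp only; omega
    · apply Fin.ext; dsimp only; omega
  · have h0 := RingQuot.mkAlgHom_rel k (BRel.kill (k := k) i j h (by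
      rintro ⟨r, h1, h2⟩
      exact h' (by omega)))
    rw [h0, map_zero, map_zero]

theorem psi_phi (n : ℕ) : (psiB k n).comp (phiB k n) = AlgHom.id k _ := by
  apply RingQuot.ringQuot_ext'
  apply RingQuot.ringQuot_ext'
  apply FreeAlgebra.hom_ext
  funext p
  obtain ⟨⟨i, j⟩, h⟩ := p
  have hy : RingQuot.mkAlgHom k (FKRel k n) (FreeAlgebra.ι k ⟨(i, j), h⟩) = yy k n i j := by
    rw [yy, Ygen, dif_pos h]
  change psiB k n (phiB k n (RingQuot.mkAlgHom k (BRel k n)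
    (RingQuot.mkAlgHom k (FKRel k n) (FreeAlgebra.ι k ⟨(i, j), h⟩)))) =
    RingQuot.mkAlgHom k (BRel k n)
      (RingQuot.mkAlgHom k (FKRel k n) (FreeAlgebra.ι k ⟨(i, j), h⟩))
  rw [hy, phiB_mk k n i j h, psi_Zim k n i j h]

/-- with `m = ⌊n/2⌋` and `I = {(1,2),(3,4),…,(2m-1,2m)}`, the
quotient `B = E_n^!/(y_{i,j} : (i,j) ∉ I)` is isomorphic as a `k`-algebra to
the `(-1)`-skew polynomial ring `k_{-1}[z_1,…,z_m]`, via `z_r ↦` the image of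
`y_{2r-1,2r}`. -/
theorem FKDual_quotient_iso_skewPoly (n : ℕ) (hn : 2 ≤ n) :
    ∃ f : SkewPoly k (n / 2) ≃ₐ[k] RingQuot (BRel k n),
      ∀ r : Fin (n / 2),
        f (RingQuot.mkAlgHom k (SkewRel k (n / 2)) (FreeAlgebra.ι k r)) =
          RingQuot.mkAlgHom k (BRel k n)
            (yy k n ⟨2 * (r : ℕ), by have := r.isLt; omega⟩
              ⟨2 * (r : ℕ) + 1, by have := r.isLt; omega⟩) := by
  exact ⟨AlgEquiv.ofAlgHom (psiB k n) (phiB k n) (psi_phi k n) (phi_psi k n),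
    fun r => psiB_mk k n r⟩

end
end

section
/- Every monomial of D_n in the generators is nonzero: for any finite (possibly empty, possibly repeating) list of pairs (i_1,j_1), …, (i_w,j_w) with 1 ≤ i_s < j_s ≤ n, the product a_{i_1,j_1} a_{i_2,j_2} ⋯ a_{i_w,j_w} is a nonzero element of D_n. -/
/- The commutative algebra `D_n` over an algebraically closed field `k` of
characteristic zero: generated by `a_{i,j}` for `1 ≤ i < j ≤ n` (with the
convention `a_{j,i} = a_{i,j}`), subject to `a_{i,j} a_{j,l} = a_{i,j} a_{i,l}`
for pairwise distinct `i, j, l`; realized as a quotient of a polynomial ring. -/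

noncomputable section

variable (k : Type) [Field k] [IsAlgClosed k] [CharZero k]

/-- Index set for the generators: pairs `(i,j)` with `i < j`. -/
abbrev DIdx (n : ℕ) := {p : Fin n × Fin n // p.1 < p.2}

/-- The generator `a_{i,j}` of the polynomial ring, with the convention
`a_{j,i} = a_{i,j}` (and `a_{i,i} = 0`, never used). -/
def Agen (n : ℕ) (i j : Fin n) : MvPolynomial (DIdx n) k :=
  if h : i < j then MvPolynomial.X ⟨(i, j), h⟩
  else if h' : j < i then MvPolynomial.X ⟨(j, i), h'⟩
  else 0

/-- The defining relations of `D_n`. -/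
def DRelSet (n : ℕ) : Set (MvPolynomial (DIdx n) k) :=
  {p | ∃ i j l : Fin n, i ≠ j ∧ j ≠ l ∧ i ≠ l ∧
    p = Agen k n i j * Agen k n j l - Agen k n i j * Agen k n i l}

/-- The commutative algebra `D_n`. -/
abbrev DAlg (n : ℕ) := MvPolynomial (DIdx n) k ⧸ Ideal.span (DRelSet k n)

/-- The generator `a_{i,j}` of `D_n`. -/
def aa (n : ℕ) (i j : Fin n) : DAlg k n :=
  Ideal.Quotient.mk (Ideal.span (DRelSet k n)) (Agen k n i j)

theorem eval_one_Agen (n : ℕ) (i j : Fin n) (h : i ≠ j) :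
    MvPolynomial.eval (fun _ => (1 : k)) (Agen k n i j) = 1 := by
  unfold Agen
  rcases lt_or_gt_of_ne h with h | h
  · simp [h]
  · simp [h, not_lt_of_gt h]

theorem eval_one_rel (n : ℕ) (p : MvPolynomial (DIdx n) k)
    (hp : p ∈ Ideal.span (DRelSet k n)) :
    MvPolynomial.eval (fun _ => (1 : k)) p = 0 := by
  have hle : Ideal.span (DRelSet k n) ≤
      RingHom.ker (MvPolynomial.eval (fun _ : DIdx n => (1 : k))) := by
    rw [Ideal.span_le]
    rintro q ⟨i, j, l, hij, hjl, hil, rfl⟩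
    simp [RingHom.mem_ker, eval_one_Agen, hij, hjl, hil]
  exact hle hp

/-- every monomial of `D_n` in the generators is nonzero: for any
finite (possibly empty, possibly repeating) list of pairs `(i_s, j_s)` with
`i_s < j_s`, the product `a_{i_1,j_1} ⋯ a_{i_w,j_w}` is nonzero in `D_n`. -/
theorem DAlg_monomials_ne_zero (n : ℕ) (hn : 2 ≤ n) (L : List (DIdx n)) :
    (L.map fun p => aa k n p.1.1 p.1.2).prod ≠ 0 := by
  intro h
  have h1 : (L.map fun p => aa k n p.1.1 p.1.2).prod =
      Ideal.Quotient.mk (Ideal.span (DRelSet k n))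
        (L.map fun p => Agen k n p.1.1 p.1.2).prod := by
    rw [map_list_prod, List.map_map]
    rfl
  rw [h1, Ideal.Quotient.eq_zero_iff_mem] at h
  have h2 := eval_one_rel k n _ h
  rw [map_list_prod, List.map_map, List.prod_eq_one] at h2
  · exact one_ne_zero h2
  · intro x hx
    obtain ⟨p, -, rfl⟩ := List.mem_map.1 hx
    exact eval_one_Agen k n _ _ (ne_of_lt p.2)

end
end

section
/- For every integer d ≥ 1, the dimension over k of the degree-d graded component of D_n equals the number of pairs (π, m), where π is a set partition of {1,…,n} having at least one block of size ≥ 2, and m assigns to each block B of π with |B| ≥ 2 an integer m_B ≥ |B| − 1, such that the sum of the m_B over all such blocks equals d. (Equivalently, the Hilbert series of D_n is H_{D_n}(t) = Σ_{π ∈ Π_n} t^{rk(π)} / (1−t)^{#_{≥2}(π)}, where Π_n is the set of set partitions of {1,…,n}, rk(π) = n − (number of blocks of π), and #_{≥2}(π) is the number of blocks of π of size at least 2.) -/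
/- The commutative algebra `D_n` over an algebraically closed field `k` of
characteristic zero: generated by `a_{i,j}` for `1 ≤ i < j ≤ n` (with the
convention `a_{j,i} = a_{i,j}`), subject to `a_{i,j} a_{j,l} = a_{i,j} a_{i,l}`
for pairwise distinct `i, j, l`; realized as a quotient of a polynomial ring. -/

noncomputable section

variable (k : Type) [Field k] [IsAlgClosed k] [CharZero k]

/-- The degree-`d` graded component of `D_n`: the image in `D_n` of the space
of homogeneous polynomials of degree `d` (each generator `a_{i,j}` has degree
one, and the defining relations are homogeneous). -/
def DComponent (n d : ℕ) : Submodule k (DAlg k n) :=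
  (MvPolynomial.homogeneousSubmodule (DIdx n) k d).map
    (Ideal.Quotient.mkₐ k (Ideal.span (DRelSet k n))).toLinearMap

/-! ### Combinatorics of monomials -/

/-- Exponent vectors. -/
abbrev Ex (n : ℕ) := DIdx n →₀ ℕ

/-- `i < j` and the edge `ij` occurs in `s`. -/
def Edg {n : ℕ} (s : Ex n) (i j : Fin n) : Prop := ∃ h : i < j, s ⟨(i, j), h⟩ ≠ 0

/-- Connectivity. -/
def Rl {n : ℕ} (s : Ex n) (i j : Fin n) : Prop := Relation.EqvGen (Edg s) i j

open Classical in
/-- number of edges in the component of `v`. -/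
def mult {n : ℕ} (s : Ex n) (v : Fin n) : ℕ := ∑ e : DIdx n, if Rl s e.1.1 v then s e else 0

/-- The invariant of a monomial. -/
def inv {n : ℕ} (s : Ex n) : (Fin n → Fin n → Prop) × (Fin n → ℕ) := (Rl s, mult s)

/-- The unordered edge. -/
def ed {n : ℕ} (i j : Fin n) (h : i ≠ j) : DIdx n :=
  if h' : i < j then ⟨(i, j), h'⟩ else ⟨(j, i), lt_of_le_of_ne (not_lt.1 h') h.symm⟩

theorem ed_comm {n : ℕ} (i j : Fin n) (h : i ≠ j) : ed i j h = ed j i h.symm := by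
  unfold ed
  rcases lt_or_gt_of_ne h with h' | h'
  · simp [h', not_lt.2 h'.le]
  · simp [h', not_lt.2 h'.le]

theorem ed_lt {n : ℕ} (i j : Fin n) (h : i < j) : ed i j h.ne = ⟨(i, j), h⟩ := by
  simp [ed, h]

theorem Rl.symm {n : ℕ} {s : Ex n} {i j : Fin n} (h : Rl s i j) : Rl s j i :=
  Relation.EqvGen.symm _ _ h

theorem Rl.trans {n : ℕ} {s : Ex n} {i j l : Fin n} (h : Rl s i j) (h' : Rl s j l) : Rl s i l :=
  Relation.EqvGen.trans _ _ _ h h'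

theorem Rl.refl {n : ℕ} (s : Ex n) (i : Fin n) : Rl s i i :=
  Relation.EqvGen.refl _

theorem Rl_of_edge {n : ℕ} {s : Ex n} (e : DIdx n) (h : s e ≠ 0) : Rl s e.1.1 e.1.2 :=
  Relation.EqvGen.rel _ _ ⟨e.2, h⟩

theorem Rl_of_ed {n : ℕ} {s : Ex n} (i j : Fin n) (hij : i ≠ j) (h : s (ed i j hij) ≠ 0) :
    Rl s i j := by
  rcases lt_or_gt_of_ne hij with h' | h'
  · rw [ed_lt _ _ h'] at h
    exact Rl_of_edge _ h
  · rw [ed_comm, ed_lt _ _ h'] at h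
    exact (Rl_of_edge _ h).symm

/-- Minimality of `Rl`. -/
theorem Rl_min {n : ℕ} {s : Ex n} {Q : Fin n → Fin n → Prop} (hQ : Equivalence Q)
    (h : ∀ e : DIdx n, s e ≠ 0 → Q e.1.1 e.1.2) {i j : Fin n} (hij : Rl s i j) : Q i j := by
  induction hij with
  | rel x y h' => obtain ⟨h1, h2⟩ := h'; exact h _ h2
  | refl x => exact hQ.refl _
  | symm x y _ ih => exact hQ.symm ih
  | trans x y z _ _ ih1 ih2 => exact hQ.trans ih1 ih2

theorem Rl_equiv {n : ℕ} (s : Ex n) : Equivalence (Rl s) :=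
  ⟨Rl.refl s, Rl.symm, Rl.trans⟩

/-- one step of the relation: `u·ij·jl` and `u·ij·il`. -/
theorem Rl_step_le {n : ℕ} (u : Ex n) (i j l : Fin n) (hij : i ≠ j) (hjl : j ≠ l) (hil : i ≠ l)
    {a b : Fin n}
    (h : Rl (u + Finsupp.single (ed i j hij) 1 + Finsupp.single (ed j l hjl) 1) a b) :
    Rl (u + Finsupp.single (ed i j hij) 1 + Finsupp.single (ed i l hil) 1) a b := by
  refine Rl_min (Rl_equiv _) ?_ h
  intro e he
  have h1 : Rl (u + Finsupp.single (ed i j hij) 1 + Finsupp.single (ed i l hil) 1) i j := by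
    apply Rl_of_ed _ _ hij; simp
  have h2 : Rl (u + Finsupp.single (ed i j hij) 1 + Finsupp.single (ed i l hil) 1) i l := by
    apply Rl_of_ed _ _ hil; simp
  by_cases hee : e = ed j l hjl
  · subst hee
    have h3 := h1.symm.trans h2
    generalize u + Finsupp.single (ed i j hij) 1 + Finsupp.single (ed i l hil) 1 = t at h3 ⊢
    unfold ed
    split_ifs
    · exact h3
    · exact h3.symm
  · apply Rl_of_edge
    simp only [Finsupp.add_apply, Finsupp.single_apply, if_neg (Ne.symm hee)] at he ⊢
    omega

theorem Rl_ed {n : ℕ} {s : Ex n} (i j : Fin n) (hij : i ≠ j) (h : Rl s i j) :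
    Rl s (ed i j hij).1.1 i := by
  unfold ed
  split_ifs
  · exact Rl.refl _ _
  · exact h.symm

open Classical in
theorem mult_add_single {n : ℕ} (u : Ex n) (e : DIdx n) (Q : Fin n → Fin n → Prop)
    (h : Rl (u + Finsupp.single e 1) = Q) (v : Fin n) :
    mult (u + Finsupp.single e 1) v =
      (∑ x : DIdx n, if Q x.1.1 v then u x else 0) + (if Q e.1.1 v then 1 else 0) := by
  subst h
  unfold mult
  generalize Rl (u + Finsupp.single e 1) = Q
  have : (if Q e.1.1 v then 1 else 0) =
      ∑ x : DIdx n, if Q x.1.1 v then Finsupp.single e 1 x else 0 := by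
    rw [Finset.sum_eq_single e]
    · simp
    · intro b _ hb
      simp [Finsupp.single_apply, hb.symm]
    · simp
  rw [this, ← Finset.sum_add_distrib]
  apply Finset.sum_congr rfl
  intro x _
  split_ifs <;> simp

theorem inv_step {n : ℕ} (u : Ex n) (i j l : Fin n) (hij : i ≠ j) (hjl : j ≠ l) (hil : i ≠ l) :
    inv (u + Finsupp.single (ed i j hij) 1 + Finsupp.single (ed j l hjl) 1) =
    inv (u + Finsupp.single (ed i j hij) 1 + Finsupp.single (ed i l hil) 1) := by
  have hR : Rl (u + Finsupp.single (ed i j hij) 1 + Finsupp.single (ed j l hjl) 1) =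
    Rl (u + Finsupp.single (ed i j hij) 1 + Finsupp.single (ed i l hil) 1) := by
    funext a b
    apply propext
    constructor
    · exact Rl_step_le u i j l hij hjl hil
    · intro h
      have := Rl_step_le u j i l hij.symm hil hjl (a := a) (b := b)
      rw [ed_comm j i] at this
      exact this h
  refine Prod.ext hR ?_
  funext v
  have key : Rl (u + Finsupp.single (ed i j hij) 1 + Finsupp.single (ed i l hil) 1)
      (ed j l hjl).1.1 v ↔ Rl (u + Finsupp.single (ed i j hij) 1 + Finsupp.single (ed i l hil) 1)
      (ed i l hil).1.1 v := by
    set t := u + Finsupp.single (ed i j hij) 1 + Finsupp.single (ed i l hil) 1 with ht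
    have h1 : Rl t i j := by apply Rl_of_ed _ _ hij; simp [ht]
    have h2 : Rl t i l := by apply Rl_of_ed _ _ hil; simp [ht]
    have h3 := Rl_ed j l hjl (h1.symm.trans h2)
    have h4 := Rl_ed i l hil h2
    exact ⟨fun h => h4.trans (h1.trans (h3.symm.trans h)),
      fun h => h3.trans (h1.symm.trans (h4.symm.trans h))⟩
  change mult _ v = mult _ v
  rw [mult_add_single _ _ _ hR, mult_add_single _ _ _ rfl]
  congr 1
  classical
  simp only [key]

/-- Normal (star-shaped) monomials. -/
def Nrm {n : ℕ} (s : Ex n) : Prop :=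
  (∀ i j l, Edg s i j → Edg s j l → False) ∧
  (∀ i j l, i < j → Edg s i l → Edg s j l → False) ∧
  (∀ i j l, j < l → Edg s i j → ∀ h : i < l, s ⟨(i, l), h⟩ ≤ 1)

theorem Nrm.rl {n : ℕ} {s : Ex n} (hs : Nrm s) {a b : Fin n} (h : Rl s a b) :
    a = b ∨ Edg s a b ∨ Edg s b a ∨ ∃ c, Edg s c a ∧ Edg s c b := by
  obtain ⟨h1, h2, -⟩ := hs
  have h2' : ∀ {i j l}, Edg s i l → Edg s j l → i = j := by
    intro i j l hi hj
    by_contra hne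
    rcases lt_or_gt_of_ne hne with h | h
    · exact h2 _ _ _ h hi hj
    · exact h2 _ _ _ h hj hi
  refine Rl_min (Q := fun a b => a = b ∨ Edg s a b ∨ Edg s b a ∨ ∃ c, Edg s c a ∧ Edg s c b)
    ⟨fun x => Or.inl rfl, ?_, ?_⟩ (fun e he => Or.inr (Or.inl ⟨e.2, he⟩)) h
  · rintro x y (h | h | h | ⟨c, h, h'⟩)
    · exact Or.inl h.symm
    · exact Or.inr (Or.inr (Or.inl h))
    · exact Or.inr (Or.inl h)
    · exact Or.inr (Or.inr (Or.inr ⟨c, h', h⟩))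
  · rintro x y z (h | h | h | ⟨c, h, h'⟩) (g | g | g | ⟨c', g, g'⟩)
    · subst h; exact Or.inl g
    · subst h; exact Or.inr (Or.inl g)
    · subst h; exact Or.inr (Or.inr (Or.inl g))
    · subst h; exact Or.inr (Or.inr (Or.inr ⟨_, g, g'⟩))
    · subst g; exact Or.inr (Or.inl h)
    · exact (h1 _ _ _ h g).elim
    · exact Or.inl (h2' h g)
    · have := h2' h g; subst this; exact Or.inr (Or.inl g')
    · subst g; exact Or.inr (Or.inr (Or.inl h))
    · exact Or.inr (Or.inr (Or.inr ⟨_, h, g⟩))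
    · exact (h1 _ _ _ g h).elim
    · exact (h1 _ _ _ g h).elim
    · subst g; exact Or.inr (Or.inr (Or.inr ⟨_, h, h'⟩))
    · exact (h1 _ _ _ h' g).elim
    · have := h2' h' g; subst this; exact Or.inr (Or.inr (Or.inl h))
    · have := h2' h' g; subst this; exact Or.inr (Or.inr (Or.inr ⟨_, h, g'⟩))

theorem Nrm.edg_iff {n : ℕ} {s : Ex n} (hs : Nrm s) (i j : Fin n) :
    Edg s i j ↔ i < j ∧ Rl s i j ∧ ∀ c, Rl s c i → i ≤ c := by
  constructor
  · intro h
    refine ⟨h.1, Relation.EqvGen.rel _ _ h, fun c hc => ?_⟩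
    rcases hs.rl hc with h' | h' | h' | ⟨c', h', h''⟩
    · exact h'.ge
    · exact (hs.1 _ _ _ h' h).elim
    · exact h'.1.le
    · exact (hs.1 _ _ _ h'' h).elim
  · rintro ⟨hij, hr, hm⟩
    rcases hs.rl hr with h' | h' | h' | ⟨c', h', h''⟩
    · exact absurd h' hij.ne
    · exact h'
    · exact absurd h'.1 (not_lt.2 hij.le)
    · have := hm c' (Relation.EqvGen.rel _ _ h')
      exact absurd h'.1 (not_lt.2 this)

theorem Nrm.ext {n : ℕ} {s t : Ex n} (hs : Nrm s) (ht : Nrm t) (h : inv s = inv t) : s = t := by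
  have hR : Rl s = Rl t := congrArg Prod.fst h
  have hm : mult s = mult t := congrArg Prod.snd h
  have hE : ∀ i j, Edg s i j ↔ Edg t i j := by
    intro i j; rw [hs.edg_iff, ht.edg_iff, hR]
  -- non-second edges have equal exponent
  have h1 : ∀ (i j l : Fin n) (hil : i < l), j < l → Edg s i j →
      s ⟨(i, l), hil⟩ = t ⟨(i, l), hil⟩ := by
    intro i j l hil hjl he
    have a1 := hs.2.2 i j l hjl he hil
    have a2 := ht.2.2 i j l hjl ((hE _ _).1 he) hil
    have a3 := hE i l
    by_cases h0 : s ⟨(i, l), hil⟩ = 0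
    · have : ¬ Edg s i l := fun ⟨_, h⟩ => h h0
      rw [a3] at this
      have h0' : t ⟨(i, l), hil⟩ = 0 := by
        by_contra h'; exact this ⟨hil, h'⟩
      rw [h0, h0']
    · obtain ⟨_, h0'⟩ := a3.1 ⟨hil, h0⟩
      omega
  ext ⟨⟨i, l⟩, hil⟩
  change i < l at hil
  by_cases h0 : Edg s i l
  swap
  · have h0' := h0
    rw [hE] at h0'
    have e1 : s ⟨(i, l), hil⟩ = 0 := by by_contra h'; exact h0 ⟨hil, h'⟩
    have e2 : t ⟨(i, l), hil⟩ = 0 := by by_contra h'; exact h0' ⟨hil, h'⟩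
    rw [e1, e2]
  by_cases hj : ∃ j, j < l ∧ Edg s i j
  · obtain ⟨j, hj, hj'⟩ := hj
    exact h1 i j l hil hj hj'
  push Not at hj
  classical
  have hsum := congrFun hm i
  simp only [mult, hR] at hsum
  rw [← Finset.add_sum_erase _ _ (Finset.mem_univ (⟨(i, l), hil⟩ : DIdx n)),
    ← Finset.add_sum_erase _ _ (Finset.mem_univ (⟨(i, l), hil⟩ : DIdx n))] at hsum
  simp only [if_pos (Rl.refl t i)] at hsum
  have : ∑ e ∈ Finset.univ.erase (⟨(i, l), hil⟩ : DIdx n), (if Rl t e.1.1 i then s e else 0) =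
    ∑ e ∈ Finset.univ.erase (⟨(i, l), hil⟩ : DIdx n), (if Rl t e.1.1 i then t e else 0) := by
    apply Finset.sum_congr rfl
    rintro ⟨⟨a, b⟩, hab⟩ he
    change a < b at hab
    split_ifs with hr
    swap
    · rfl
    change Rl t a i at hr
    by_cases h0' : Edg s a b
    · have : a = i := by
        apply le_antisymm
        · exact ((hs.edg_iff _ _).1 h0').2.2 _ (by rw [hR]; exact hr.symm)
        · exact ((hs.edg_iff _ _).1 h0).2.2 _ (by rw [hR]; exact hr)
      subst this
      have hbl : b ≠ l := by
        rintro rfl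
        simp at he
      have hlb : l < b := by
        rcases lt_or_gt_of_ne hbl with h | h
        · exact absurd h0' (hj b h)
        · exact h
      exact h1 _ l _ hab hlb h0
    · have h0'' := h0'
      rw [hE] at h0''
      have e1 : s ⟨(a, b), hab⟩ = 0 := by by_contra h'; exact h0' ⟨hab, h'⟩
      have e2 : t ⟨(a, b), hab⟩ = 0 := by by_contra h'; exact h0'' ⟨hab, h'⟩
      rw [e1, e2]
  omega

/-- Weight used for the reduction. -/
def wt {n : ℕ} (s : Ex n) : ℕ := ∑ e : DIdx n, s e * (e.1.1.val + e.1.2.val)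

theorem wt_add {n : ℕ} (s t : Ex n) : wt (s + t) = wt s + wt t := by
  simp [wt, add_mul, Finset.sum_add_distrib]

theorem wt_single {n : ℕ} (e : DIdx n) : wt (Finsupp.single e 1) = e.1.1.val + e.1.2.val := by
  classical
  simp [wt, Finsupp.single_apply]

theorem exists_sub {n : ℕ} {s : Ex n} {e : DIdx n} (h : s e ≠ 0) :
    ∃ u, s = u + Finsupp.single e 1 := by
  refine ⟨s - Finsupp.single e 1, ?_⟩
  rw [tsub_add_cancel_of_le]
  simpa [Nat.one_le_iff_ne_zero] using h

/-- Any function invariant under the relations reduces to normal monomials. -/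
theorem exists_nrm {n : ℕ} {α : Type*} (F : Ex n → α)
    (hF : ∀ (u : Ex n) (i j l : Fin n) (hij : i ≠ j) (hjl : j ≠ l) (hil : i ≠ l),
      F (u + Finsupp.single (ed i j hij) 1 + Finsupp.single (ed j l hjl) 1) =
      F (u + Finsupp.single (ed i j hij) 1 + Finsupp.single (ed i l hil) 1)) (s : Ex n) :
    ∃ t, F t = F s ∧ Nrm t := by
  induction hw : wt s using Nat.strong_induction_on generalizing s with
  | _ w ih =>
  by_cases hs : Nrm s
  · exact ⟨s, rfl, hs⟩
  suffices h : ∃ t, F t = F s ∧ wt t < wt s by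
    obtain ⟨t, h1, h2⟩ := h
    obtain ⟨t', h3, h4⟩ := ih (wt t) (hw ▸ h2) t rfl
    exact ⟨t', h3.trans h1, h4⟩
  clear ih
  unfold Nrm at hs
  rw [not_and_or, not_and_or] at hs
  -- relation b
  have hFb : ∀ (u : Ex n) (i j l : Fin n) (hij : i < j) (hjl : j < l) (hil : i < l),
      F (u + Finsupp.single ⟨(i, l), hil⟩ 1 + Finsupp.single ⟨(j, l), hjl⟩ 1) =
      F (u + Finsupp.single ⟨(i, l), hil⟩ 1 + Finsupp.single ⟨(i, j), hij⟩ 1) := by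
    intro u i j l hij hjl hil
    have := hF u i l j hil.ne hjl.ne' hij.ne
    rwa [ed_lt _ _ hil, ed_lt _ _ hij, ed_comm, ed_lt _ _ hjl] at this
  have hFa : ∀ (u : Ex n) (i j l : Fin n) (hij : i < j) (hjl : j < l) (hil : i < l),
      F (u + Finsupp.single ⟨(i, j), hij⟩ 1 + Finsupp.single ⟨(j, l), hjl⟩ 1) =
      F (u + Finsupp.single ⟨(i, j), hij⟩ 1 + Finsupp.single ⟨(i, l), hil⟩ 1) := by
    intro u i j l hij hjl hil
    have := hF u i j l hij.ne hjl.ne hil.ne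
    rwa [ed_lt _ _ hil, ed_lt _ _ hij, ed_lt _ _ hjl] at this
  rcases hs with hs | hs | hs
  · push Not at hs
    obtain ⟨i, j, l, ⟨hij, h1⟩, ⟨hjl, h2⟩, -⟩ := hs
    obtain ⟨u, rfl⟩ := exists_sub h2
    have h3 : u ⟨(i, j), hij⟩ ≠ 0 := by
      intro h0; apply h1; simp [h0, Finsupp.single_apply, hij.ne']
    obtain ⟨u, rfl⟩ := exists_sub h3
    refine ⟨_, (hFa u i j l hij hjl (hij.trans hjl)).symm, ?_⟩
    simp only [wt_add, wt_single]
    have : i.val < j.val := hij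
    omega
  · push Not at hs
    obtain ⟨i, j, l, hij, ⟨hil, h1⟩, ⟨hjl, h2⟩, -⟩ := hs
    obtain ⟨u, rfl⟩ := exists_sub h2
    have h3 : u ⟨(i, l), hil⟩ ≠ 0 := by
      intro h0; apply h1; simp [h0, Finsupp.single_apply, hij.ne']
    obtain ⟨u, rfl⟩ := exists_sub h3
    refine ⟨_, (hFb u i j l hij hjl hil).symm, ?_⟩
    simp only [wt_add, wt_single]
    have : i.val < j.val := hij
    have : j.val < l.val := hjl
    omega
  · push Not at hs
    obtain ⟨i, j, l, hjl, ⟨hij, h1⟩, hil, h2⟩ := hs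
    obtain ⟨u, rfl⟩ := exists_sub (s := s) (e := ⟨(i, l), hil⟩) (by omega)
    have h3 : u ⟨(i, l), hil⟩ ≠ 0 := by
      intro h0; simp [h0] at h2
    obtain ⟨u, rfl⟩ := exists_sub h3
    have h4 : u ⟨(i, j), hij⟩ ≠ 0 := by
      intro h0; apply h1; simp [h0, Finsupp.single_apply, hjl.ne']
    obtain ⟨u, rfl⟩ := exists_sub h4
    refine ⟨u + Finsupp.single ⟨(i, j), hij⟩ 1 + Finsupp.single ⟨(i, l), hil⟩ 1 +
      Finsupp.single ⟨(i, j), hij⟩ 1, ?_, ?_⟩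
    · rw [← hFb _ i j l hij hjl hil]
      have := hFa (u + Finsupp.single ⟨(i, l), hil⟩ 1) i j l hij hjl hil
      convert this using 2 <;> abel
    · simp only [wt_add, wt_single]
      have : j.val < l.val := hjl
      omega

theorem inv_surj_nrm {n : ℕ} (s : Ex n) : ∃ t, inv t = inv s ∧ Nrm t :=
  exists_nrm inv inv_step s

/-! ### Matching invariants with partitions -/

theorem degree_eq {n : ℕ} (s : Ex n) : s.degree = ∑ e, s e := by
  rw [Finsupp.degree_apply]
  exact Finset.sum_subset (Finset.subset_univ _) (by intro x _ hx; simpa using hx)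

/-- number of edges starting in `B`. -/
def blk {n : ℕ} (P : Finpartition (Finset.univ : Finset (Fin n))) (s : Ex n)
    (B : Finset (Fin n)) : ℕ := ∑ e : DIdx n with P.part e.1.1 = B, s e

theorem sum_blk {n : ℕ} (P : Finpartition (Finset.univ : Finset (Fin n))) (s : Ex n) :
    ∑ B ∈ P.parts, blk P s B = s.degree := by
  rw [degree_eq]
  exact Finset.sum_fiberwise_of_maps_to (fun e _ => by simp) _

theorem mult_eq_blk {n : ℕ} (P : Finpartition (Finset.univ : Finset (Fin n))) (s : Ex n)
    (h : ∀ i j, Rl s i j ↔ P.part i = P.part j) (v : Fin n) : mult s v = blk P s (P.part v) := by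
  classical
  simp only [mult, blk, h, Finset.sum_filter]

theorem blk_small {n : ℕ} (P : Finpartition (Finset.univ : Finset (Fin n))) (s : Ex n)
    (h : ∀ i j, Rl s i j → P.part i = P.part j) (B : Finset (Fin n)) (hB : ¬ 2 ≤ B.card) :
    blk P s B = 0 := by
  apply Finset.sum_eq_zero
  intro e he
  simp only [Finset.mem_filter, Finset.mem_univ, true_and] at he
  by_contra h0
  have h1 := h _ _ (Rl_of_edge e h0)
  apply hB
  have : 1 < B.card := Finset.one_lt_card.2 ⟨e.1.1, by rw [← he]; simp, e.1.2,
    by rw [← he, h1]; simp, e.2.ne⟩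
  exact this

theorem sum_blk_filter {n : ℕ} (P : Finpartition (Finset.univ : Finset (Fin n))) (s : Ex n)
    (h : ∀ i j, Rl s i j → P.part i = P.part j) :
    ∑ B ∈ P.parts.filter (fun B => 2 ≤ B.card), blk P s B = s.degree := by
  rw [← sum_blk P s]
  apply Finset.sum_filter_of_ne
  intro B _ hB
  by_contra h'
  exact hB (blk_small P s h B h')

/-- lower bound on the number of edges. -/
theorem le_mult {n : ℕ} (P : Finpartition (Finset.univ : Finset (Fin n))) (s : Ex n)
    (h : ∀ i j, Rl s i j ↔ P.part i = P.part j) (B : Finset (Fin n)) (hB : B ∈ P.parts) :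
    B.card - 1 ≤ blk P s B := by
  obtain ⟨t, ht, hn⟩ := inv_surj_nrm s
  have hR : Rl t = Rl s := congrArg Prod.fst ht
  have hm : mult t = mult s := congrArg Prod.snd ht
  obtain ⟨v, hv⟩ := P.nonempty_of_mem_parts hB
  have hvB : P.part v = B := P.part_eq_of_mem hB hv
  have h' : ∀ i j, Rl t i j ↔ P.part i = P.part j := by rw [hR]; exact h
  have : blk P s B = blk P t B := by
    rw [← hvB, ← mult_eq_blk P s h, ← mult_eq_blk P t h', hm]
  rw [this]
  set μ := B.min' ⟨v, hv⟩ with hμ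
  have hμB : μ ∈ B := Finset.min'_mem _ _
  have hμp : P.part μ = B := P.part_eq_of_mem hB hμB
  have hE : ∀ j ∈ B.erase μ, Edg t μ j := by
    intro j hj
    rw [Finset.mem_erase] at hj
    rw [hn.edg_iff]
    refine ⟨lt_of_le_of_ne (Finset.min'_le _ _ hj.2) hj.1.symm, ?_, ?_⟩
    · rw [h', hμp, P.part_eq_of_mem hB hj.2]
    · intro c hc
      rw [h', hμp] at hc
      exact Finset.min'_le _ _ (by rw [← hc]; simp)
  classical
  calc B.card - 1 = (B.erase μ).card := (Finset.card_erase_of_mem hμB).symm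
    _ ≤ (Finset.univ.filter (fun e : DIdx n => P.part e.1.1 = B ∧ t e ≠ 0)).card := by
      refine Finset.card_le_card_of_surjOn (fun e => e.1.2) ?_
      intro j hj
      obtain ⟨h1, h2⟩ := hE j hj
      exact ⟨⟨(μ, j), h1⟩, by simp [hμp, h2], rfl⟩
    _ = ∑ e : DIdx n with P.part e.1.1 = B ∧ t e ≠ 0, 1 := by simp
    _ ≤ ∑ e : DIdx n with P.part e.1.1 = B ∧ t e ≠ 0, t e := by
      apply Finset.sum_le_sum
      intro e he
      simp only [Finset.mem_filter] at he
      omega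
    _ ≤ blk P t B := by
      apply Finset.sum_le_sum_of_subset
      intro e he
      simp only [Finset.mem_filter] at he ⊢
      exact ⟨he.1, he.2.1⟩

open Classical in
/-- the star monomial attached to a partition and multiplicities, as a function of two indices -/
def starG {n : ℕ} (P : Finpartition (Finset.univ : Finset (Fin n))) (m : Finset (Fin n) → ℕ)
    (i j : Fin n) : ℕ :=
  if (∀ c ∈ P.part i, i ≤ c) ∧ P.part i = P.part j then
    1 + (if ∀ c ∈ P.part i, c ≤ j then m (P.part i) - ((P.part i).card - 1) else 0)
  else 0

/-- the star monomial -/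
def star {n : ℕ} (P : Finpartition (Finset.univ : Finset (Fin n))) (m : Finset (Fin n) → ℕ) :
    Ex n := Finsupp.equivFunOnFinite.symm (fun e => starG P m e.1.1 e.1.2)

theorem star_apply {n : ℕ} (P : Finpartition (Finset.univ : Finset (Fin n)))
    (m : Finset (Fin n) → ℕ) (e : DIdx n) : star P m e = starG P m e.1.1 e.1.2 := rfl

theorem starG_ne {n : ℕ} (P : Finpartition (Finset.univ : Finset (Fin n)))
    (m : Finset (Fin n) → ℕ) (i j : Fin n) :
    starG P m i j ≠ 0 ↔ (∀ c ∈ P.part i, i ≤ c) ∧ P.part i = P.part j := by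
  unfold starG
  split_ifs <;> simp_all

theorem star_rl {n : ℕ} (P : Finpartition (Finset.univ : Finset (Fin n)))
    (m : Finset (Fin n) → ℕ) (i j : Fin n) : Rl (star P m) i j ↔ P.part i = P.part j := by
  constructor
  · intro h
    refine Rl_min (Q := fun i j => P.part i = P.part j)
      ⟨fun _ => rfl, fun h => h.symm, fun h h' => h.trans h'⟩ ?_ h
    intro e he
    rw [star_apply, starG_ne] at he
    exact he.2
  · have key : ∀ i, Rl (star P m) ((P.part i).min' ⟨i, by simp⟩) i := by
      intro i
      set μ := (P.part i).min' ⟨i, by simp⟩ with hμ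
      have hμB : μ ∈ P.part i := Finset.min'_mem _ _
      have hμp : P.part μ = P.part i := P.part_eq_of_mem (by simp) hμB
      have hle : μ ≤ i := Finset.min'_le _ _ (by simp)
      rcases hle.eq_or_lt with h | h
      · rw [h]; exact Rl.refl _ _
      · apply Rl_of_edge (⟨(μ, i), h⟩ : DIdx n)
        rw [star_apply, starG_ne]
        exact ⟨fun c hc => Finset.min'_le _ _ (by rwa [← hμp]), hμp⟩
    intro h
    have h1 := key i
    have h2 := key j
    simp only [h] at h1
    exact h1.symm.trans h2

theorem star_blk {n : ℕ} (P : Finpartition (Finset.univ : Finset (Fin n)))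
    (m : Finset (Fin n) → ℕ) (B : Finset (Fin n)) (hB : B ∈ P.parts) (hc : 2 ≤ B.card)
    (hm : B.card - 1 ≤ m B) : blk P (star P m) B = m B := by
  classical
  have hne := P.nonempty_of_mem_parts hB
  set μ := B.min' hne with hμ
  set ν := B.max' hne with hν
  have hμB : μ ∈ B := Finset.min'_mem _ _
  have hνB : ν ∈ B := Finset.max'_mem _ _
  have hμp : P.part μ = B := P.part_eq_of_mem hB hμB
  have hμν : μ ≠ ν := (Finset.min'_lt_max'_of_card B (by omega)).ne
  have h1 : blk P (star P m) B = ∑ j ∈ B.erase μ, starG P m μ j := by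
    unfold blk
    refine Finset.sum_bij_ne_zero (fun e _ _ => e.1.2) ?_ ?_ ?_ ?_
    · intro e he h0
      simp only [Finset.mem_filter, Finset.mem_univ, true_and] at he
      rw [star_apply, starG_ne, he] at h0
      have : μ ≤ e.1.1 := Finset.min'_le _ _ (by rw [← he]; simp)
      refine Finset.mem_erase.2 ⟨(this.trans_lt e.2).ne', ?_⟩
      rw [h0.2]; simp
    · intro e he h0 e' he' h0' hee
      simp only [Finset.mem_filter, Finset.mem_univ, true_and] at he he'
      rw [star_apply, starG_ne, he] at h0
      rw [star_apply, starG_ne, he'] at h0'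
      apply Subtype.ext
      refine Prod.ext (le_antisymm (h0.1 _ ?_) (h0'.1 _ ?_)) hee
      · rw [← he']; simp
      · rw [← he]; simp
    · intro j hj h0
      rw [Finset.mem_erase] at hj
      have hlt : μ < j := lt_of_le_of_ne (Finset.min'_le _ _ hj.2) hj.1.symm
      exact ⟨⟨(μ, j), hlt⟩, by simp [hμp], by simpa [star_apply] using h0, rfl⟩
    · intro e he h0
      simp only [Finset.mem_filter, Finset.mem_univ, true_and] at he
      rw [star_apply, starG_ne, he] at h0
      have : μ = e.1.1 := le_antisymm (Finset.min'_le _ _ (by rw [← he]; simp)) (h0.1 _ hμB)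
      rw [star_apply, this]
  rw [h1]
  have h2 : ∀ j ∈ B.erase μ, starG P m μ j = 1 + if j = ν then m B - (B.card - 1) else 0 := by
    intro j hj
    rw [Finset.mem_erase] at hj
    have hjp : P.part j = B := P.part_eq_of_mem hB hj.2
    unfold starG
    rw [hμp, hjp, if_pos ⟨fun c hc => Finset.min'_le _ _ hc, rfl⟩]
    congr 1
    have : (∀ c ∈ B, c ≤ j) ↔ j = ν := by
      constructor
      · intro h
        exact le_antisymm (Finset.le_max' _ _ hj.2) (h _ hνB)
      · rintro rfl c hc
        exact Finset.le_max' _ _ hc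
    simp only [this]
  rw [Finset.sum_congr rfl h2, Finset.sum_add_distrib, Finset.sum_ite_eq',
    if_pos (Finset.mem_erase.2 ⟨hμν.symm, hνB⟩)]
  simp only [Finset.sum_const, smul_eq_mul, mul_one, Finset.card_erase_of_mem hμB]
  omega

theorem part_ext {n : ℕ} {P Q : Finpartition (Finset.univ : Finset (Fin n))}
    (h : ∀ i j, P.part i = P.part j ↔ Q.part i = Q.part j) : P = Q := by
  have h1 : ∀ i, P.part i = Q.part i := by
    intro i
    ext j
    rw [P.mem_part_iff_part_eq_part (by simp) (by simp),
      Q.mem_part_iff_part_eq_part (by simp) (by simp), h]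
  ext B
  constructor
  · intro hB
    obtain ⟨v, hv⟩ := P.nonempty_of_mem_parts hB
    rw [← P.part_eq_of_mem hB hv, h1]; simp
  · intro hB
    obtain ⟨v, hv⟩ := Q.nonempty_of_mem_parts hB
    rw [← Q.part_eq_of_mem hB hv, ← h1]; simp

/-- The set of invariants in degree `d`. -/
def InvSet (n d : ℕ) : Set ((Fin n → Fin n → Prop) × (Fin n → ℕ)) :=
  {y | ∃ s : Ex n, s.degree = d ∧ inv s = y}

/-- The condition on pairs. -/
def PCond (n d : ℕ) (x : Finpartition (Finset.univ : Finset (Fin n)) × (Finset (Fin n) → ℕ)) :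
    Prop :=
  (∃ B ∈ x.1.parts, 2 ≤ B.card) ∧
      (∀ B ∈ x.1.parts, 2 ≤ B.card → B.card - 1 ≤ x.2 B) ∧
      (∀ B : Finset (Fin n), ¬(B ∈ x.1.parts ∧ 2 ≤ B.card) → x.2 B = 0) ∧
      (∑ B ∈ x.1.parts.filter (fun B => 2 ≤ B.card), x.2 B) = d

theorem card_pairs (n d : ℕ) (hd : 1 ≤ d) :
    Nat.card (InvSet n d) = Nat.card {x // PCond n d x} := by
  symm
  have hmem : ∀ x : {x // PCond n d x}, ((fun i j => x.1.1.part i = x.1.1.part j),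
      (fun v => x.1.2 (x.1.1.part v))) ∈ InvSet n d := by
    rintro ⟨⟨P, m⟩, h1, h2, h3, h4⟩
    dsimp only at h1 h2 h3 h4 ⊢
    have hb : ∀ B ∈ P.parts, blk P (star P m) B = m B := by
      intro B hB
      by_cases hc : 2 ≤ B.card
      · exact star_blk P m B hB hc (h2 B hB hc)
      · rw [h3 B (fun h => hc h.2)]
        exact blk_small P _ (fun i j h => (star_rl P m i j).1 h) B hc
    refine ⟨star P m, ?_, Prod.ext ?_ ?_⟩
    · rw [← sum_blk_filter P _ (fun i j h => (star_rl P m i j).1 h), ← h4]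
      apply Finset.sum_congr rfl
      intro B hB
      exact hb B (Finset.mem_filter.1 hB).1
    · funext i j
      exact propext (star_rl P m i j)
    · funext v
      change mult (star P m) v = _
      rw [mult_eq_blk P _ (star_rl P m), hb _ (by simp)]
  refine Nat.card_congr (Equiv.ofBijective (fun x => ⟨_, hmem x⟩) ⟨?_, ?_⟩)
  · rintro ⟨⟨P, m⟩, h1, h2, h3, h4⟩ ⟨⟨Q, m'⟩, h1', h2', h3', h4'⟩ hxy
    dsimp only at h1 h2 h3 h4 h1' h2' h3' h4'
    have hxy := congrArg Subtype.val hxy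
    dsimp only at hxy
    have e1 := congrArg Prod.fst hxy
    have e2 := congrArg Prod.snd hxy
    dsimp only at e1 e2
    have hPQ : P = Q := part_ext (fun i j => (congrFun (congrFun e1 i) j).to_iff)
    subst hPQ
    have : m = m' := by
      funext B
      by_cases hB : B ∈ P.parts ∧ 2 ≤ B.card
      · obtain ⟨v, hv⟩ := P.nonempty_of_mem_parts hB.1
        have := congrFun e2 v
        rwa [P.part_eq_of_mem hB.1 hv] at this
      · rw [h3 B hB, h3' B hB]
    subst this
    rfl
  · rintro ⟨_, s, hs, rfl⟩
    classical
    let S : Setoid (Fin n) := ⟨Rl s, Rl_equiv s⟩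
    let P : Finpartition (Finset.univ : Finset (Fin n)) := Finpartition.ofSetoid S
    have hP : ∀ i j, Rl s i j ↔ P.part i = P.part j := by
      intro i j
      rw [← P.mem_part_iff_part_eq_part (by simp) (by simp),
        Finpartition.mem_part_ofSetoid_iff_rel]
      exact ⟨Rl.symm, Rl.symm⟩
    let m : Finset (Fin n) → ℕ := fun B => if B ∈ P.parts ∧ 2 ≤ B.card then blk P s B else 0
    have hsum : (∑ B ∈ P.parts.filter (fun B => 2 ≤ B.card), m B) = d := by
      rw [← hs, ← sum_blk_filter P s (fun i j h => (hP i j).1 h)]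
      apply Finset.sum_congr rfl
      intro B hB
      exact if_pos (Finset.mem_filter.1 hB)
    refine ⟨⟨(P, m), ?_, ?_, ?_, hsum⟩, ?_⟩
    · by_contra hcon
      push Not at hcon
      rw [Finset.filter_false_of_mem (fun B hB => not_le.2 (hcon B hB))] at hsum
      simp at hsum
      omega
    · intro B hB hc
      change _ ≤ m B
      rw [show m B = blk P s B from if_pos ⟨hB, hc⟩]
      exact le_mult P s hP B hB
    · intro B hB
      exact if_neg hB
    · apply Subtype.ext
      refine Prod.ext ?_ ?_
      · funext i j
        exact propext (hP i j).symm
      · funext v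
        change m (P.part v) = mult s v
        rw [mult_eq_blk P s hP]
        by_cases hc : 2 ≤ (P.part v).card
        · exact if_pos ⟨by simp, hc⟩
        · rw [blk_small P s (fun i j h => (hP i j).1 h) _ hc]
          exact if_neg (fun h => hc h.2)

/-! ### Linear algebra -/

/-- class of a monomial -/
def Pm {n : ℕ} (s : Ex n) : DAlg k n :=
  Ideal.Quotient.mk (Ideal.span (DRelSet k n)) (MvPolynomial.monomial s 1)


theorem Agen_eq {n : ℕ} (i j : Fin n) (h : i ≠ j) :
    Agen k n i j = MvPolynomial.monomial (Finsupp.single (ed i j h) 1) 1 := by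
  unfold Agen ed
  rcases lt_or_gt_of_ne h with h' | h'
  · simp [h', MvPolynomial.X]
  · simp [h', not_lt.2 h'.le, MvPolynomial.X]

theorem rel_mul {n : ℕ} (u : Ex n) (i j l : Fin n) (hij : i ≠ j) (hjl : j ≠ l) (hil : i ≠ l) :
    MvPolynomial.monomial u (1 : k) *
      (Agen k n i j * Agen k n j l - Agen k n i j * Agen k n i l) =
    MvPolynomial.monomial (u + Finsupp.single (ed i j hij) 1 + Finsupp.single (ed j l hjl) 1) 1 -
    MvPolynomial.monomial (u + Finsupp.single (ed i j hij) 1 + Finsupp.single (ed i l hil) 1) 1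
    := by
  rw [Agen_eq k i j hij, Agen_eq k j l hjl, Agen_eq k i l hil]
  simp only [mul_sub, MvPolynomial.monomial_mul, mul_one, add_assoc]

theorem Pm_step {n : ℕ} (u : Ex n) (i j l : Fin n) (hij : i ≠ j) (hjl : j ≠ l) (hil : i ≠ l) :
    Pm k (u + Finsupp.single (ed i j hij) 1 + Finsupp.single (ed j l hjl) 1) =
    Pm k (u + Finsupp.single (ed i j hij) 1 + Finsupp.single (ed i l hil) 1) := by
  unfold Pm
  rw [Ideal.Quotient.eq, ← rel_mul]
  exact Ideal.mul_mem_left _ _ (Ideal.subset_span ⟨i, j, l, hij, hjl, hil, rfl⟩)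

/-- The linear map recording invariants. -/
def Lm (n : ℕ) : MvPolynomial (DIdx n) k →ₗ[k]
    (((Fin n → Fin n → Prop) × (Fin n → ℕ)) →₀ k) :=
  (MvPolynomial.basisMonomials (DIdx n) k).constr k (fun s => Finsupp.single (inv s) 1)

theorem Lm_monomial {n : ℕ} (s : Ex n) :
    Lm k n (MvPolynomial.monomial s 1) = Finsupp.single (inv s) 1 := by
  have := (MvPolynomial.basisMonomials (DIdx n) k).constr_basis k
    (fun s => Finsupp.single (inv s) (1 : k)) s
  rwa [MvPolynomial.coe_basisMonomials] at this

theorem Lm_ideal {n : ℕ} (p : MvPolynomial (DIdx n) k) (hp : p ∈ Ideal.span (DRelSet k n)) :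
    Lm k n p = 0 := by
  suffices h : ∀ q, Lm k n (q * p) = 0 by simpa using h 1
  induction hp using Submodule.span_induction with
  | mem x hx =>
    obtain ⟨i, j, l, hij, hjl, hil, rfl⟩ := hx
    intro q
    induction q using MvPolynomial.induction_on' with
    | monomial u a =>
      have : MvPolynomial.monomial u a = a • MvPolynomial.monomial u (1 : k) := by
        simp [MvPolynomial.smul_monomial]
      rw [this, smul_mul_assoc, map_smul, rel_mul k u i j l hij hjl hil, map_sub,
        Lm_monomial, Lm_monomial, inv_step u i j l hij hjl hil, sub_self, smul_zero]
    | add p q hp hq => rw [add_mul, map_add, hp, hq, add_zero]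
  | zero => simp
  | add x y _ _ hx hy => intro q; rw [mul_add, map_add, hx, hy, add_zero]
  | smul a x _ hx => intro q; rw [smul_eq_mul, ← mul_assoc]; exact hx _

theorem Lm_eq_of_Pm {n : ℕ} (p q : MvPolynomial (DIdx n) k)
    (h : Ideal.Quotient.mk (Ideal.span (DRelSet k n)) p = Ideal.Quotient.mk _ q) :
    Lm k n p = Lm k n q := by
  rw [Ideal.Quotient.eq] at h
  have := Lm_ideal k _ h
  rwa [map_sub, sub_eq_zero] at this

theorem Pm_eq {n : ℕ} {s t : Ex n} (h : inv s = inv t) : Pm k s = Pm k t := by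
  have H : ∀ s : Ex n, ∃ t, Pm k t = Pm k s ∧ inv t = inv s ∧ Nrm t := by
    intro s
    obtain ⟨t, h1, h2⟩ := exists_nrm (fun s => (Pm k s, inv s))
      (fun u i j l a b c => Prod.ext (Pm_step k u i j l a b c) (inv_step u i j l a b c)) s
    exact ⟨t, congrArg Prod.fst h1, congrArg Prod.snd h1, h2⟩
  obtain ⟨s', a1, a2, a3⟩ := H s
  obtain ⟨t', b1, b2, b3⟩ := H t
  have : s' = t' := a3.ext b3 (by rw [a2, b2, h])
  rw [← a1, ← b1, this]

/-- Representative of an invariant. -/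
def rep {n d : ℕ} (y : InvSet n d) : Ex n := y.2.choose

theorem rep_spec {n d : ℕ} (y : InvSet n d) : (rep y).degree = d ∧ inv (rep y) = y.1 :=
  y.2.choose_spec

theorem indep (n d : ℕ) : LinearIndependent k (fun y : InvSet n d => Pm k (rep y)) := by
  rw [linearIndependent_iff]
  intro c hc
  have h1 : Lm k n (c.sum fun y a => a • MvPolynomial.monomial (rep y) (1 : k)) = 0 := by
    rw [← map_zero (Lm k n)]
    apply Lm_eq_of_Pm
    rw [map_zero, ← hc, Finsupp.linearCombination_apply, Finsupp.sum, Finsupp.sum, map_sum]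
    rfl
  rw [Finsupp.sum, map_sum] at h1
  ext y
  have h2 := DFunLike.congr_fun h1 y.1
  simp only [map_smul, Lm_monomial, (rep_spec _).2] at h2
  classical
  simp only [Finsupp.finsetSum_apply, Finsupp.smul_apply, Finsupp.single_apply, Subtype.val_inj,
    smul_eq_mul, mul_ite, mul_one, mul_zero,
    Finsupp.coe_zero, Pi.zero_apply] at h2
  rw [Finset.sum_eq_single y] at h2
  · rw [if_pos rfl] at h2
    exact h2
  · intro b _ hb
    exact if_neg hb
  · intro h
    rw [if_pos rfl]
    simpa using h

theorem comp_eq_span (n d : ℕ) :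
    DComponent k n d = Submodule.span k (Set.range (fun y : InvSet n d => Pm k (rep y))) := by
  apply le_antisymm
  · rintro _ ⟨p, hp, rfl⟩
    have hp : p.IsHomogeneous d := hp
    rw [p.as_sum, map_sum]
    apply Submodule.sum_mem
    intro s hs
    have hdeg : s.degree = d := by
      rw [Finsupp.degree_eq_weight_one]
      exact hp (by simpa using hs)
    have : MvPolynomial.monomial s (p.coeff s) = p.coeff s • MvPolynomial.monomial s (1 : k) := by
      simp [MvPolynomial.smul_monomial]
    rw [this, map_smul]
    apply Submodule.smul_mem
    let y : InvSet n d := ⟨inv s, s, hdeg, rfl⟩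
    have hy : Pm k s = Pm k (rep y) := Pm_eq k (rep_spec y).2.symm
    change Pm k s ∈ _
    rw [hy]
    exact Submodule.subset_span ⟨y, rfl⟩
  · rw [Submodule.span_le]
    rintro _ ⟨y, rfl⟩
    exact ⟨MvPolynomial.monomial (rep y) 1,
      MvPolynomial.isHomogeneous_monomial _ (rep_spec y).1, rfl⟩

/-- for `d ≥ 1`, the `k`-dimension of the degree-`d` component of
`D_n` equals the number of pairs `(π, m)` where `π` is a set partition of
`{1,…,n}` with at least one block of size `≥ 2`, and `m` assigns to each block
`B` of `π` with `|B| ≥ 2` an integer `m_B ≥ |B| - 1` (and `0` to everything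
else), with `∑ m_B = d`. -/
theorem DAlg_hilbert_coefficient (n : ℕ) (hn : 2 ≤ n) (d : ℕ) (hd : 1 ≤ d) :
    Module.finrank k (DComponent k n d) =
    Nat.card {x : Finpartition (Finset.univ : Finset (Fin n)) × (Finset (Fin n) → ℕ) //
      (∃ B ∈ x.1.parts, 2 ≤ B.card) ∧
      (∀ B ∈ x.1.parts, 2 ≤ B.card → B.card - 1 ≤ x.2 B) ∧
      (∀ B : Finset (Fin n), ¬(B ∈ x.1.parts ∧ 2 ≤ B.card) → x.2 B = 0) ∧
      (∑ B ∈ x.1.parts.filter (fun B => 2 ≤ B.card), x.2 B) = d} := by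
  rw [comp_eq_span, Module.finrank_eq_nat_card_basis (Module.Basis.span (indep k n d))]
  exact card_pairs n d hd

end
end
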